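/- arXiv:1602.01443 — 11 statements merged into one kernel-verified Lean document; each statement's English description precedes it below -/
import Mathlib

section
/- Let E be a some-pairs problem with n inputs per side and m = |E| outputs, let q be a reducer size with q < n/2, and suppose every input of X and every input of Y is an endpoint of at least one edge of E. If E has a mapping schema of reducer size q with replication rate r, then E also has a complete mapping schema of reducer size q whose replication rate is at most 6r. -/
/-- Merging reducers as long as two of them fit into one yields a family that covers the same
pairs at no greater total size, and in which any two reducers have combined size above `q`. -/
theorem exists_merged_schema {ι α β : Type*} [DecidableEq ι] [DecidableEq α] [DecidableEq β]
    (q : ℕ) (I : Finset ι) (S : ι → Finset α) (T : ι → Finset β)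
    (hS : ∀ i ∈ I, (S i).card ≤ q) (hT : ∀ i ∈ I, (T i).card ≤ q) :
    ∃ (J : Finset ι) (S' : ι → Finset α) (T' : ι → Finset β),
      (∀ i ∈ J, (S' i).card ≤ q) ∧ (∀ i ∈ J, (T' i).card ≤ q) ∧
      (∀ x y, (∃ i ∈ I, x ∈ S i ∧ y ∈ T i) → ∃ i ∈ J, x ∈ S' i ∧ y ∈ T' i) ∧
      ∑ i ∈ J, ((S' i).card + (T' i).card) ≤ ∑ i ∈ I, ((S i).card + (T i).card) ∧
      ∀ i ∈ J, ∀ j ∈ J, i ≠ j →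
        q < ((S' i).card + (T' i).card) + ((S' j).card + (T' j).card) := by
  induction hk : I.card using Nat.strong_induction_on generalizing I S T with
  | _ k ih =>
  by_cases h : ∀ i ∈ I, ∀ j ∈ I, i ≠ j →
      q < ((S i).card + (T i).card) + ((S j).card + (T j).card)
  · exact ⟨I, S, T, hS, hT, fun _ _ hxy => hxy, le_rfl, h⟩
  push Not at h
  obtain ⟨i, hi, j, hj, hij, hle⟩ := h
  have hSu := Finset.card_union_le (S i) (S j)
  have hTu := Finset.card_union_le (T i) (T j)
  have hiJ : i ∈ I.erase j := Finset.mem_erase.2 ⟨hij, hi⟩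
  obtain ⟨J, S', T', h1, h2, h3, h4, h5⟩ := ih (I.erase j).card
    (hk ▸ Finset.card_erase_lt_of_mem hj) (I.erase j)
    (Function.update S i (S i ∪ S j)) (Function.update T i (T i ∪ T j))
    (by
      intro l hl
      by_cases hli : l = i
      · subst hli; simp only [Function.update_self]; omega
      · simpa [hli] using hS l (Finset.mem_of_mem_erase hl))
    (by
      intro l hl
      by_cases hli : l = i
      · subst hli; simp only [Function.update_self]; omega
      · simpa [hli] using hT l (Finset.mem_of_mem_erase hl)) rfl
  refine ⟨J, S', T', h1, h2, ?_, h4.trans ?_, h5⟩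
  · rintro x y ⟨l, hl, hx, hy⟩
    apply h3
    by_cases hli : l = i
    · subst hli; exact ⟨l, hiJ, by simp [hx], by simp [hy]⟩
    by_cases hlj : l = j
    · subst hlj; exact ⟨i, hiJ, by simp [hx], by simp [hy]⟩
    · exact ⟨l, Finset.mem_erase.2 ⟨hlj, hl⟩, by simp [hli, hx], by simp [hli, hy]⟩
  · rw [← Finset.add_sum_erase I _ hj, ← Finset.add_sum_erase _ _ hiJ,
      ← Finset.add_sum_erase (I.erase j) (fun l => (S l).card + (T l).card) hiJ]
    have hrest : ∑ l ∈ (I.erase j).erase i, ((Function.update S i (S i ∪ S j) l).card +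
        (Function.update T i (T i ∪ T j) l).card) =
        ∑ l ∈ (I.erase j).erase i, ((S l).card + (T l).card) :=
      Finset.sum_congr rfl fun l hl => by simp [Finset.ne_of_mem_erase hl]
    rw [hrest]
    simp only [Function.update_self]
    omega

/-- If any two weights add up to at least `q`, all but one of them are at least `q / 2`. -/
theorem card_mul_le_two_mul_sum_add {ι : Type*} [DecidableEq ι] (q : ℕ) (J : Finset ι)
    (w : ι → ℕ) (h : ∀ i ∈ J, ∀ j ∈ J, i ≠ j → q ≤ w i + w j) :
    J.card * q ≤ 2 * ∑ i ∈ J, w i + q := by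
  by_cases hw : ∀ i ∈ J, q ≤ 2 * w i
  · have := Finset.card_nsmul_le_sum J _ q hw
    rw [← Finset.mul_sum, smul_eq_mul] at this
    omega
  push Not at hw
  obtain ⟨i, hi, hlt⟩ := hw
  have hrest := Finset.card_nsmul_le_sum (J.erase i) (fun j => 2 * w j) q fun j hj => by
    have := h i hi j (Finset.mem_of_mem_erase hj) (Finset.ne_of_mem_erase hj).symm
    omega
  rw [← Finset.mul_sum, smul_eq_mul] at hrest
  rw [← Finset.add_sum_erase J _ hi, ← Finset.card_erase_add_one hi, add_mul]
  omega


/-- If a some-pairs problem `E` (with `n` inputs per side, every input an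
endpoint of an edge) with reducer size `q < n/2` has a mapping schema with replication
rate `r`, then it has a complete mapping schema with replication rate at most `6r`. -/
theorem some_pairs_complete_schema (n m q : ℕ) (E : Finset (Fin n × Fin n))
    (hm : E.card = m)
    (hq : 2 * q < n)
    (hX : ∀ x : Fin n, ∃ y : Fin n, (x, y) ∈ E)
    (hY : ∀ y : Fin n, ∃ x : Fin n, (x, y) ∈ E)
    (p : ℕ) (S T : Fin p → Finset (Fin n))
    (hS : ∀ i, (S i).card ≤ q) (hT : ∀ i, (T i).card ≤ q)
    (hcover : ∀ e ∈ E, ∃ i, e.1 ∈ S i ∧ e.2 ∈ T i)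
    (r : ℝ) (hr : r = (∑ i, ((S i).card + (T i).card : ℝ)) / (2 * n)) :
    ∃ (p' : ℕ) (S' T' : Fin p' → Finset (Fin n)),
      (∀ i, (S' i).card = q) ∧ (∀ i, (T' i).card = q) ∧
      (∀ e ∈ E, ∃ i, e.1 ∈ S' i ∧ e.2 ∈ T' i) ∧
      (∑ i, ((S' i).card + (T' i).card : ℝ)) / (2 * n) ≤ 6 * r := by
  obtain ⟨J, S', T', hS', hT', hcov, hsum, hpair⟩ :=
    exists_merged_schema q Finset.univ S T (fun i _ => hS i) (fun i _ => hT i)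
  have hn : n ≤ ∑ i, (S i).card := by
    have huniv : (Finset.univ : Finset (Fin n)) ⊆ Finset.univ.biUnion S := fun x _ => by
      obtain ⟨y, hy⟩ := hX x
      obtain ⟨i, hi, -⟩ := hcover _ hy
      exact Finset.mem_biUnion.2 ⟨i, Finset.mem_univ i, hi⟩
    simpa using (Finset.card_le_card huniv).trans Finset.card_biUnion_le
  have hcard := card_mul_le_two_mul_sum_add q J _ fun i hi j hj hij => (hpair i hi j hj hij).le
  have hbound : J.card * q ≤ 3 * ∑ i, ((S i).card + (T i).card) := by
    have : ∑ i, (S i).card ≤ ∑ i, ((S i).card + (T i).card) :=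
      Finset.sum_le_sum fun i _ => Nat.le_add_right _ _
    omega
  have pad : ∀ A : Finset (Fin n), A.card ≤ q → ∃ B, A ⊆ B ∧ B.card = q := fun A hA =>
    Finset.exists_superset_card_eq hA (by simp; omega)
  choose f hf hfq using fun i : J => pad (S' i) (hS' i i.2)
  choose g hg hgq using fun i : J => pad (T' i) (hT' i i.2)
  refine ⟨J.card, fun k => f (J.equivFin.symm k), fun k => g (J.equivFin.symm k),
    fun _ => hfq _, fun _ => hgq _, fun e he => ?_, ?_⟩
  · obtain ⟨i, hi⟩ := hcover e he
    obtain ⟨j, hj, hx, hy⟩ := hcov _ _ ⟨i, Finset.mem_univ i, hi⟩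
    exact ⟨J.equivFin ⟨j, hj⟩, by simpa using hf ⟨j, hj⟩ hx, by simpa using hg ⟨j, hj⟩ hy⟩
  · have hbound' : (J.card * q : ℝ) ≤ 3 * ∑ i, ((S i).card + (T i).card : ℝ) := by
      exact_mod_cast hbound
    rw [hr, ← mul_div_assoc]
    gcongr
    simp only [hfq, hgq, Finset.sum_const, Finset.card_univ, Fintype.card_fin, nsmul_eq_mul]
    linarith
end

section
/- Fix S ⊆ X and T ⊆ Y with |S| ≤ q and |T| ≤ q, and let μ = m·q²/n². For every δ ≥ 2e − 1, the probability that C(S,T) > (1+δ)·μ is at most 2^{−δ·μ}. -/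
open scoped Classical

/-- The generating function of the number of samples that fall into `A`, summed over all
`m`-tuples of samples. -/
theorem sum_pow_card_filter_mem {α : Type*} [Fintype α] (A : Finset α) (m : ℕ) (t : ℝ) :
    ∑ f : Fin m → α, t ^ (Finset.univ.filter (fun j : Fin m => f j ∈ A)).card
      = ((Fintype.card α : ℝ) + A.card * (t - 1)) ^ m := by
  have h : (Fintype.card α : ℝ) + A.card * (t - 1) = ∑ a : α, if a ∈ A then t else 1 := by
    have h1 : ∀ a : α, (if a ∈ A then t else 1) = 1 + if a ∈ A then t - 1 else 0 := by
      intro a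
      split_ifs <;> ring
    simp [h1, Finset.sum_add_distrib, mul_sub]
  rw [h, Fintype.sum_pow]
  refine Finset.sum_congr rfl fun f _ => ?_
  rw [← Finset.prod_filter, Finset.prod_const]

/-- Exponential Markov bound for the number of samples that fall into `A`. -/
theorem card_filter_lt_card_mul_rpow_le {α : Type*} [Fintype α] (A : Finset α) (m : ℕ)
    {t : ℝ} (ht : 1 ≤ t) (a : ℝ) :
    ((Finset.univ.filter (fun f : Fin m → α =>
        ((Finset.univ.filter (fun j : Fin m => f j ∈ A)).card : ℝ) > a)).card : ℝ) * t ^ a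
      ≤ ((Fintype.card α : ℝ) + A.card * (t - 1)) ^ m := by
  rw [← sum_pow_card_filter_mem, ← nsmul_eq_mul]
  refine (Finset.card_nsmul_le_sum _ _ _ fun f hf => ?_).trans
    (Finset.sum_le_sum_of_subset_of_nonneg (Finset.filter_subset _ _) fun f _ _ => by positivity)
  rw [← Real.rpow_natCast]
  exact Real.rpow_le_rpow_of_exponent_le ht (Finset.mem_filter.mp hf).2.le

/-- The Chernoff factor `e ^ δ / (1 + δ) ^ (1 + δ)` is at most `2 ^ (-δ)` for `δ ≥ 2e - 1`;
here with both sides raised to the power `μ`. -/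
theorem exp_mul_le_two_rpow_mul_rpow {μ δ : ℝ} (hμ : 0 ≤ μ) (hδ : 2 * Real.exp 1 - 1 ≤ δ) :
    Real.exp (μ * δ) ≤ (2 : ℝ) ^ (-(δ * μ)) * (1 + δ) ^ ((1 + δ) * μ) := by
  have he := Real.exp_pos 1
  have hbase : 2 * Real.exp 1 ≤ 1 + δ := by linarith
  have hexp : 0 ≤ (1 + δ) * μ := mul_nonneg (by linarith) hμ
  calc Real.exp (μ * δ)
      ≤ (2 : ℝ) ^ μ * Real.exp ((1 + δ) * μ) := by
        refine (Real.exp_le_exp.mpr (by linarith)).trans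
          (le_mul_of_one_le_left (Real.exp_pos _).le (Real.one_le_rpow one_le_two hμ))
    _ = (2 : ℝ) ^ (-(δ * μ)) * (2 * Real.exp 1) ^ ((1 + δ) * μ) := by
        rw [Real.mul_rpow two_pos.le he.le, ← mul_assoc, ← Real.rpow_add two_pos,
          Real.exp_one_rpow]
        ring_nf
    _ ≤ (2 : ℝ) ^ (-(δ * μ)) * (1 + δ) ^ ((1 + δ) * μ) := by gcongr



/-- Chernoff-type bound for a fixed pair of sets `S, T` of size at most `q`:
for `δ ≥ 2e − 1`, the probability (over `m` independent uniformly random edges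
`f : Fin m → Fin n × Fin n`) that `C(S,T) > (1+δ)·μ`, where `μ = m·q²/n²`, is at most
`2^{−δ·μ}`. -/
theorem some_pairs_chernoff_large_delta (n m q : ℕ) (hn : 0 < n)
    (S T : Finset (Fin n)) (hS : S.card ≤ q) (hT : T.card ≤ q)
    (μ δ : ℝ) (hμ : μ = (m : ℝ) * q ^ 2 / n ^ 2)
    (hδ : δ ≥ 2 * Real.exp 1 - 1) :
    ((Finset.univ.filter (fun f : Fin m → Fin n × Fin n =>
        (((Finset.univ.filter (fun j : Fin m => f j ∈ S ×ˢ T)).card : ℝ) > (1 + δ) * μ))).card : ℝ)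
      / (Fintype.card (Fin m → Fin n × Fin n) : ℝ)
      ≤ (2 : ℝ) ^ (-(δ * μ)) := by
  have hn' : (0 : ℝ) < n := by exact_mod_cast hn
  have hμ0 : 0 ≤ μ := by rw [hμ]; positivity
  have hδ0 : 0 ≤ δ := by linarith [Real.add_one_le_exp 1]
  have hbound := card_filter_lt_card_mul_rpow_le (S ×ˢ T) m (t := 1 + δ) (by linarith)
    ((1 + δ) * μ)
  have hcard : (((S ×ˢ T).card : ℕ) : ℝ) ≤ (q : ℝ) ^ 2 := by
    rw [Finset.card_product, sq]
    exact_mod_cast Nat.mul_le_mul hS hT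
  have hmgf : ((Fintype.card (Fin n × Fin n) : ℝ) + (S ×ˢ T).card * (1 + δ - 1)) ^ m
      ≤ (Fintype.card (Fin m → Fin n × Fin n) : ℝ) * Real.exp (μ * δ) := by
    have hfactor : (Fintype.card (Fin n × Fin n) : ℝ) + (S ×ˢ T).card * (1 + δ - 1)
        ≤ (n : ℝ) ^ 2 * Real.exp (q ^ 2 / n ^ 2 * δ) := by
      calc (Fintype.card (Fin n × Fin n) : ℝ) + (S ×ˢ T).card * (1 + δ - 1)
          ≤ (n : ℝ) ^ 2 + q ^ 2 * δ := by
            rw [add_sub_cancel_left, Fintype.card_prod, Fintype.card_fin, Nat.cast_mul, ← sq]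
            gcongr
        _ = (n : ℝ) ^ 2 * (q ^ 2 / n ^ 2 * δ + 1) := by field_simp; ring
        _ ≤ _ := by gcongr; exact Real.add_one_le_exp _
    refine (pow_le_pow_left₀ (by rw [add_sub_cancel_left]; positivity) hfactor m).trans_eq ?_
    rw [mul_pow, ← Real.exp_nat_mul, hμ]
    simp only [Fintype.card_pi_const, Fintype.card_prod, Fintype.card_fin, Nat.cast_pow,
      Nat.cast_mul]
    ring_nf
  have hpow : 0 < (1 + δ) ^ ((1 + δ) * μ) := Real.rpow_pos_of_pos (by linarith) _
  have : Nonempty (Fin n) := ⟨⟨0, hn⟩⟩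
  have htotal : (0 : ℝ) < Fintype.card (Fin m → Fin n × Fin n) := by
    exact_mod_cast Fintype.card_pos
  rw [div_le_iff₀ htotal]
  refine le_of_mul_le_mul_right ?_ hpow
  calc _ ≤ _ := by convert hbound
    _ ≤ _ := hmgf
    _ ≤ (Fintype.card (Fin m → Fin n × Fin n) : ℝ)
          * ((2 : ℝ) ^ (-(δ * μ)) * (1 + δ) ^ ((1 + δ) * μ)) := by
        gcongr
        exact exp_mul_le_two_rpow_mul_rpow hμ0 hδ
    _ = _ := by ring
end

section
/- Suppose m ≥ (2^{3e}/e)·n and 1 ≤ q ≤ n²/m. Then there exists a some-pairs problem f : Fin m → X × Y with n inputs per side and m (possibly repeated) edges that is (q, φ)-expanding for φ = 6·q·log₂(en/q). -/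
open Finset in
/-- The number of functions sending every index of `J` into `A`. -/
theorem card_filter_forall_mem {ι α : Type*} [Fintype ι] [DecidableEq ι] [Fintype α]
    [DecidableEq α] (J : Finset ι) (A : Finset α)
    [DecidablePred fun f : ι → α => ∀ j ∈ J, f j ∈ A] :
    #{f : ι → α | ∀ j ∈ J, f j ∈ A} =
      #A ^ #J * Fintype.card α ^ (Fintype.card ι - #J) := by
  have h : ({f : ι → α | ∀ j ∈ J, f j ∈ A} : Finset (ι → α)) =
      Fintype.piFinset fun j => if j ∈ J then A else univ := by
    ext f
    simp only [mem_filter, mem_univ, true_and, Fintype.mem_piFinset]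
    refine forall_congr' fun j => ?_
    by_cases hj : j ∈ J <;> simp [hj]
  rw [h, Fintype.card_piFinset, ← card_compl, ← card_univ (α := α), ← prod_const, ← prod_const,
    ← prod_mul_prod_compl J]
  congr 1
  · exact prod_congr rfl fun j hj => by rw [if_pos hj]
  · exact prod_congr rfl fun j hj => by rw [if_neg (mem_compl.mp hj)]

open Finset in
/-- Union bound: some function hits every set of the family fewer than `k` times. -/
theorem exists_forall_card_filter_mem_lt {α : Type*} [Fintype α] [DecidableEq α] {m k s : ℕ}
    (F : Finset (Finset α)) (hF : ∀ A ∈ F, #A ≤ s)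
    (h : #F * m.choose k * (s ^ k * Fintype.card α ^ (m - k)) < Fintype.card α ^ m) :
    ∃ f : Fin m → α, ∀ A ∈ F, #{j | f j ∈ A} < k := by
  by_contra! hbad
  refine h.not_ge ?_
  have hcover : (univ : Finset (Fin m → α)) ⊆
      (F ×ˢ powersetCard k (univ : Finset (Fin m))).biUnion
        fun p => {f : Fin m → α | ∀ j ∈ p.2, f j ∈ p.1} := by
    intro f _
    obtain ⟨A, hA, hk⟩ := hbad f
    obtain ⟨J, hJ, hJk⟩ := exists_subset_card_eq hk
    simp only [mem_biUnion, mem_product, mem_powersetCard, mem_filter, mem_univ, true_and]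
    exact ⟨(A, J), ⟨hA, subset_univ _, hJk⟩, fun j hj => by simpa using hJ hj⟩
  calc Fintype.card α ^ m = #(univ : Finset (Fin m → α)) := by simp
    _ ≤ _ := card_le_card hcover
    _ ≤ #(F ×ˢ powersetCard k (univ : Finset (Fin m))) *
          (s ^ k * Fintype.card α ^ (m - k)) := by
        refine card_biUnion_le_card_mul _ _ _ fun p hp => ?_
        simp only [mem_product, mem_powersetCard] at hp
        rw [card_filter_forall_mem, hp.2.2, Fintype.card_fin]
        gcongr
        exact hF _ hp.1
    _ = _ := by simp

theorem pow_div_factorial_le_exp_mul_div_pow {x : ℝ} (hx : 0 ≤ x) {k : ℕ} (hk : 0 < k) :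
    x ^ k / k.factorial ≤ (Real.exp 1 * x / k) ^ k := by
  have hk' : (0 : ℝ) < k := by exact_mod_cast hk
  have h := Real.pow_div_factorial_le_exp (k : ℝ) hk'.le k
  rw [← Real.exp_one_pow] at h
  calc x ^ k / k.factorial = (x / k) ^ k * ((k : ℝ) ^ k / k.factorial) := by
        rw [div_pow]; field_simp
    _ ≤ (x / k) ^ k * Real.exp 1 ^ k := by gcongr
    _ = _ := by rw [← mul_pow]; congr 1; ring

theorem choose_le_exp_mul_div_pow (n : ℕ) {k : ℕ} (hk : 0 < k) :
    (n.choose k : ℝ) ≤ (Real.exp 1 * n / k) ^ k :=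
  (Nat.choose_le_pow_div k n).trans (pow_div_factorial_le_exp_mul_div_pow n.cast_nonneg hk)

/-- The expected number of bad triples in the union bound is less than one. -/
theorem choose_sq_mul_choose_mul_pow_lt {n m q k : ℕ} (hq : 1 ≤ q) (hqn : q ≤ n)
    (hmq : m * q ≤ n ^ 2)
    (hk : 6 * q * Real.logb 2 (Real.exp 1 * n / q) < k) :
    n.choose q ^ 2 * m.choose k * (q ^ 2) ^ k < (n ^ 2) ^ k := by
  have hq0 : (0 : ℝ) < q := by exact_mod_cast hq
  have hqn' : (q : ℝ) ≤ n := by exact_mod_cast hqn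
  have hn0 : (0 : ℝ) < n := hq0.trans_le hqn'
  have hmq' : (m : ℝ) * q ≤ (n : ℝ) ^ 2 := by exact_mod_cast hmq
  have he2 : 2 < Real.exp 1 := by linarith [Real.exp_one_gt_d9]
  have he3 : Real.exp 1 < 3 := by linarith [Real.exp_one_lt_d9]
  set x := Real.exp 1 * n / q with hx
  have hx2 : 2 ≤ x := by
    rw [hx, le_div_iff₀ hq0]
    nlinarith
  have hL : 1 ≤ Real.logb 2 x := by
    rw [Real.le_logb_iff_rpow_le one_lt_two (by linarith)]
    simpa using hx2
  have hkq : 6 * (q : ℝ) < k := by nlinarith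
  have hk0 : (0 : ℝ) < k := by linarith
  have hkpos : 0 < k := by exact_mod_cast hk0
  have hchoose : (n.choose q : ℝ) ^ 2 < 2 ^ k := by
    calc (n.choose q : ℝ) ^ 2 ≤ (x ^ q) ^ 2 := by
          gcongr
          exact choose_le_exp_mul_div_pow n hq
      _ = (2 : ℝ) ^ (Real.logb 2 x * (q * 2 : ℕ)) := by
          rw [Real.rpow_mul_natCast two_pos.le,
            Real.rpow_logb two_pos (by norm_num) (by linarith), pow_mul]
      _ < (2 : ℝ) ^ (k : ℝ) := by
          refine Real.rpow_lt_rpow_of_exponent_lt one_lt_two ?_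
          push_cast
          nlinarith
      _ = 2 ^ k := Real.rpow_natCast _ _
  have hedges : (m.choose k : ℝ) * ((q : ℝ) ^ 2) ^ k ≤ ((n : ℝ) ^ 2) ^ k * (1 / 2) ^ k := by
    calc (m.choose k : ℝ) * ((q : ℝ) ^ 2) ^ k
        ≤ (m : ℝ) ^ k / k.factorial * ((q : ℝ) ^ 2) ^ k := by
          gcongr
          exact Nat.choose_le_pow_div k m
      _ = (m * q : ℝ) ^ k * ((q : ℝ) ^ k / k.factorial) := by ring
      _ ≤ ((n : ℝ) ^ 2) ^ k * (Real.exp 1 * q / k) ^ k := by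
          gcongr
          exact pow_div_factorial_le_exp_mul_div_pow hq0.le hkpos
      _ ≤ _ := by
          refine mul_le_mul_of_nonneg_left (pow_le_pow_left₀ (by positivity) ?_ k) (by positivity)
          rw [div_le_iff₀ hk0]
          nlinarith
  have hreal : (n.choose q : ℝ) ^ 2 * (m.choose k * ((q : ℝ) ^ 2) ^ k) < ((n : ℝ) ^ 2) ^ k := by
    calc _ ≤ (n.choose q : ℝ) ^ 2 * (((n : ℝ) ^ 2) ^ k * (1 / 2) ^ k) := by gcongr
      _ < 2 ^ k * (((n : ℝ) ^ 2) ^ k * (1 / 2) ^ k) := by gcongr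
      _ = ((n : ℝ) ^ 2) ^ k := by
          rw [mul_left_comm, ← mul_pow 2]
          norm_num
  rw [mul_assoc]
  exact_mod_cast hreal

/-- If `m ≥ (2^{3e}/e)·n` and `1 ≤ q ≤ n²/m`, then there exists a
some-pairs problem `f : Fin m → Fin n × Fin n` (with possibly repeated edges) that is
`(q, φ)`-expanding for `φ = 6·q·log₂(en/q)`. -/
theorem exists_expanding_some_pairs_small_q (n m q : ℕ)
    (hm : (m : ℝ) ≥ (2 : ℝ) ^ (3 * Real.exp 1) / Real.exp 1 * n)
    (hq1 : 1 ≤ q) (hq2 : (q : ℝ) ≤ (n : ℝ) ^ 2 / m) :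
    ∃ f : Fin m → Fin n × Fin n,
      ∀ S T : Finset (Fin n), S.card ≤ q → T.card ≤ q →
        ((Finset.univ.filter (fun j : Fin m => f j ∈ S ×ˢ T)).card : ℝ)
          ≤ 6 * q * Real.logb 2 (Real.exp 1 * n / q) := by
  have hm0 : (0 : ℝ) < m := by
    rcases (Nat.cast_nonneg (α := ℝ) m).eq_or_lt with h | h
    · rw [← h, div_zero] at hq2
      have : (1 : ℝ) ≤ q := by exact_mod_cast hq1
      linarith
    · exact h
  have hconst : 1 ≤ (2 : ℝ) ^ (3 * Real.exp 1) / Real.exp 1 := by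
    have he1 : 2 < Real.exp 1 := by linarith [Real.exp_one_gt_d9]
    have he3 : Real.exp 1 < 3 := by linarith [Real.exp_one_lt_d9]
    rw [le_div_iff₀ (Real.exp_pos 1), one_mul]
    calc Real.exp 1 ≤ (2 : ℝ) ^ (2 : ℝ) := by norm_num; linarith
      _ ≤ _ := Real.rpow_le_rpow_of_exponent_le one_le_two (by linarith)
  have hnm : (n : ℝ) ≤ m := (le_mul_of_one_le_left n.cast_nonneg hconst).trans hm
  have hmq' : (q : ℝ) * m ≤ (n : ℝ) ^ 2 := (le_div_iff₀ hm0).mp hq2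
  have hmq : m * q ≤ n ^ 2 := by
    rw [mul_comm]
    exact_mod_cast hmq'
  have hqn : q ≤ n := by
    have hnm' : n ≤ m := by exact_mod_cast hnm
    exact le_of_mul_le_mul_left (by nlinarith : m * q ≤ m * n) (by exact_mod_cast hm0)
  set φ := 6 * q * Real.logb 2 (Real.exp 1 * n / q)
  set k := ⌊φ⌋₊ + 1
  have hk : φ < k := by exact_mod_cast Nat.lt_floor_add_one φ
  let F : Finset (Finset (Fin n × Fin n)) :=
    (Finset.powersetCard q Finset.univ ×ˢ Finset.powersetCard q Finset.univ).image
      fun p => p.1 ×ˢ p.2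
  have hFcard : F.card ≤ n.choose q ^ 2 :=
    Finset.card_image_le.trans_eq (by simp [sq])
  have hF : ∀ A ∈ F, A.card ≤ q ^ 2 := by
    intro A hA
    obtain ⟨p, hp, rfl⟩ := Finset.mem_image.mp hA
    simp only [Finset.mem_product, Finset.mem_powersetCard] at hp
    rw [Finset.card_product, hp.1.2, hp.2.2, sq]
  have hn : 0 < n ^ 2 := pow_pos (hq1.trans hqn) 2
  have hcount : F.card * m.choose k *
      ((q ^ 2) ^ k * Fintype.card (Fin n × Fin n) ^ (m - k)) <
        Fintype.card (Fin n × Fin n) ^ m := by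
    have hα : Fintype.card (Fin n × Fin n) = n ^ 2 := by simp [sq]
    rw [hα]
    rcases lt_or_ge m k with hmk | hkm
    · rw [Nat.choose_eq_zero_of_lt hmk, mul_zero, zero_mul]
      exact pow_pos hn m
    · calc _ ≤ n.choose q ^ 2 * m.choose k * ((q ^ 2) ^ k * (n ^ 2) ^ (m - k)) := by gcongr
        _ = n.choose q ^ 2 * m.choose k * (q ^ 2) ^ k * (n ^ 2) ^ (m - k) := by ring
        _ < (n ^ 2) ^ k * (n ^ 2) ^ (m - k) :=
            Nat.mul_lt_mul_of_pos_right (choose_sq_mul_choose_mul_pow_lt hq1 hqn hmq hk)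
              (pow_pos hn _)
        _ = (n ^ 2) ^ m := by rw [← pow_add, Nat.add_sub_cancel' hkm]
  obtain ⟨f, hf⟩ := exists_forall_card_filter_mem_lt F hF hcount
  refine ⟨f, fun S T hS hT => ?_⟩
  obtain ⟨S', hSS', hS'⟩ := Finset.exists_superset_card_eq hS (by simpa using hqn)
  obtain ⟨T', hTT', hT'⟩ := Finset.exists_superset_card_eq hT (by simpa using hqn)
  have hmem : S' ×ˢ T' ∈ F :=
    Finset.mem_image.mpr ⟨(S', T'), by simp [hS', hT'], rfl⟩
  have hle : (Finset.univ.filter fun j => f j ∈ S ×ˢ T).card ≤ ⌊φ⌋₊ :=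
    (Finset.card_le_card (Finset.monotone_filter_right _ fun j _ hj =>
      Finset.product_subset_product hSS' hTT' hj)).trans (Nat.lt_succ_iff.mp (hf _ hmem))
  have hq0 : (0 : ℝ) < q := by exact_mod_cast hq1
  have hqn' : (q : ℝ) ≤ n := by exact_mod_cast hqn
  have hφ : 0 ≤ φ := by
    refine mul_nonneg (by positivity) (Real.logb_nonneg one_lt_two ?_)
    rw [one_le_div hq0]
    nlinarith [Real.add_one_le_exp 1]
  exact (Nat.le_floor_iff hφ).mp hle
end

section
/- Suppose m ≥ (2^{3e}/e)·n and 1 ≤ q < n/2, and additionally that either q ≤ n²/m or q ≥ n²·ln(en/q)/m. Then there exists a some-pairs problem f : Fin m → X × Y with n inputs per side and m (possibly repeated) edges such that every complete mapping schema of reducer size q for f has replication rate r ≥ min( n/(3q), (m/n)·(1/(6·log₂(en/q))) ). -/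
theorem Nat.choose_le_exp_one_mul_div_pow (n q : ℕ) (hq : 1 ≤ q) :
    (n.choose q : ℝ) ≤ (Real.exp 1 * n / q) ^ q := by
  have hq0 : (0 : ℝ) < q := by exact_mod_cast hq
  have hexp : (q : ℝ) ^ q / q.factorial ≤ Real.exp 1 ^ q := by
    rw [← Real.exp_nat_mul, mul_one]
    exact Real.pow_div_factorial_le_exp (q : ℝ) hq0.le q
  calc (n.choose q : ℝ) ≤ (n : ℝ) ^ q / q.factorial := Nat.choose_le_pow_div q n
    _ = (n / q : ℝ) ^ q * ((q : ℝ) ^ q / q.factorial) := by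
      rw [div_pow, div_mul_div_cancel₀ (by positivity)]
    _ ≤ (n / q : ℝ) ^ q * Real.exp 1 ^ q := by gcongr
    _ = (Real.exp 1 * n / q) ^ q := by rw [← mul_pow]; congr 1; ring

/-- If every map `Fin m → Fin n × Fin n` takes its values in a union of `P` squares of side `q`,
then counting the maps and the families of squares gives an inequality. -/
theorem pow_le_choose_pow_mul_of_forall_cover (n m q P : ℕ)
    (h : ∀ f : Fin m → Fin n × Fin n, ∃ S T : Fin P → Finset (Fin n),
      (∀ i, (S i).card = q) ∧ (∀ i, (T i).card = q) ∧
        ∀ j, ∃ i, (f j).1 ∈ S i ∧ (f j).2 ∈ T i) :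
    (n ^ 2) ^ m ≤ n.choose q ^ (2 * P) * (P * q ^ 2) ^ m := by
  classical
  set A : Finset (Fin P → Finset (Fin n)) :=
    Fintype.piFinset fun _ => Finset.powersetCard q Finset.univ with hA
  let F : (Fin P → Finset (Fin n)) × (Fin P → Finset (Fin n)) →
      Finset (Fin m → Fin n × Fin n) := fun ST =>
    Fintype.piFinset fun _ => Finset.univ.biUnion fun i => ST.1 i ×ˢ ST.2 i
  have hcover : (Finset.univ : Finset (Fin m → Fin n × Fin n)) ⊆ (A ×ˢ A).biUnion F := by
    intro f _
    obtain ⟨S, T, hS, hT, hf⟩ := h f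
    refine Finset.mem_biUnion.2 ⟨(S, T), ?_, ?_⟩
    · simp [hA, Finset.mem_powersetCard, hS, hT]
    · simpa [F, Fintype.mem_piFinset] using hf
  have hF : ∀ ST ∈ A ×ˢ A, (F ST).card ≤ (P * q ^ 2) ^ m := by
    rintro ⟨S, T⟩ hST
    simp only [hA, Finset.mem_product, Fintype.mem_piFinset, Finset.mem_powersetCard] at hST
    simp only [F, Fintype.card_piFinset, Finset.prod_const, Finset.card_univ, Fintype.card_fin]
    gcongr
    refine (Finset.card_biUnion_le_card_mul _ _ (q ^ 2) fun i _ => ?_).trans (by simp)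
    rw [Finset.card_product, (hST.1 i).2, (hST.2 i).2, sq]
  have hcard := (Finset.card_le_card hcover).trans (Finset.card_biUnion_le_card_mul _ _ _ hF)
  have hAcard : A.card = n.choose q ^ P := by simp [hA, Fintype.card_piFinset]
  have huniv : (Finset.univ : Finset (Fin m → Fin n × Fin n)).card = (n ^ 2) ^ m := by
    simp [sq]
  rwa [huniv, Finset.card_product, hAcard, ← pow_add, ← two_mul] at hcard

/-- Under the stated conditions on `n`, `m`, `q`, there exists a some-pairs
problem `f : Fin m → Fin n × Fin n` such that every *complete* mapping schema of reducer
size `q` for `f` has replication rate at least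
`min( n/(3q), (m/n)·(1/(6·log₂(en/q))) )`. -/
theorem some_pairs_lower_bound_complete (n m q : ℕ)
    (hm : (m : ℝ) ≥ (2 : ℝ) ^ (3 * Real.exp 1) / Real.exp 1 * n)
    (hq1 : 1 ≤ q) (hqn : 2 * q < n)
    (hcase : (q : ℝ) ≤ (n : ℝ) ^ 2 / m ∨
      (q : ℝ) ≥ (n : ℝ) ^ 2 * Real.log (Real.exp 1 * n / q) / m) :
    ∃ f : Fin m → Fin n × Fin n,
      ∀ (p : ℕ) (S T : Fin p → Finset (Fin n)),
        (∀ i, (S i).card = q) → (∀ i, (T i).card = q) →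
        (∀ j : Fin m, ∃ i, (f j).1 ∈ S i ∧ (f j).2 ∈ T i) →
        (∑ i, ((S i).card + (T i).card : ℝ)) / (2 * n) ≥
          min ((n : ℝ) / (3 * q))
              ((m : ℝ) / n * (1 / (6 * Real.logb 2 (Real.exp 1 * n / q)))) := by
  have hq0 : (0 : ℝ) < q := by exact_mod_cast hq1
  have hqn' : (2 : ℝ) * q < n := by exact_mod_cast hqn
  have hn0 : (0 : ℝ) < n := by linarith
  have hm0 : (0 : ℝ) < m := lt_of_lt_of_le (by positivity) hm
  set L : ℝ := Real.exp 1 * n / q with hL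
  have hL1 : 1 < L := by
    rw [hL, one_lt_div hq0]
    nlinarith [Real.add_one_le_exp (1 : ℝ)]
  have hlog : 0 < Real.logb 2 L := Real.logb_pos one_lt_two hL1
  set M : ℝ := min ((n : ℝ) / (3 * q)) ((m : ℝ) / n * (1 / (6 * Real.logb 2 L))) with hM
  have hM0 : 0 < M := lt_min (by positivity) (by positivity)
  by_contra! hcon
  -- the largest number of reducers whose replication rate is below `M`
  set P : ℕ := ⌈n * M / q⌉₊ - 1 with hP
  have hceil : 0 < ⌈n * M / q⌉₊ := Nat.ceil_pos.2 (by positivity)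
  have hPM : (P : ℝ) * q < n * M := by
    rw [← lt_div_iff₀ hq0, ← Nat.lt_ceil]
    omega
  have hcount : (n ^ 2) ^ m ≤ n.choose q ^ (2 * P) * (P * q ^ 2) ^ m := by
    refine pow_le_choose_pow_mul_of_forall_cover n m q P fun f => ?_
    obtain ⟨p, S, T, hS, hT, hf, hr⟩ := hcon f
    have hpP : p ≤ P := by
      suffices p < ⌈n * M / q⌉₊ by omega
      rw [Nat.lt_ceil, lt_div_iff₀ hq0]
      simp only [hS, hT, Finset.sum_const, Finset.card_univ, Fintype.card_fin,
        nsmul_eq_mul] at hr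
      rw [div_lt_iff₀ (by positivity)] at hr
      linarith
    obtain ⟨S₀, -, hS₀⟩ := Finset.exists_subset_card_eq
      (s := (Finset.univ : Finset (Fin n))) (n := q) (by simp; omega)
    refine ⟨fun i => if h : i.1 < p then S ⟨i, h⟩ else S₀,
      fun i => if h : i.1 < p then T ⟨i, h⟩ else S₀, fun i => ?_, fun i => ?_, fun j => ?_⟩
    · dsimp only; split_ifs <;> simp [hS, hS₀]
    · dsimp only; split_ifs <;> simp [hT, hS₀]
    · obtain ⟨i, hi⟩ := hf j
      exact ⟨Fin.castLE hpP i, by simpa using hi⟩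
  have hchoose : (n.choose q : ℝ) ^ (2 * P) ≤ 2 ^ m := by
    have hexponent : Real.logb 2 L * (2 * (P * q)) ≤ m := by
      have h1 : n * M ≤ n * ((m : ℝ) / n * (1 / (6 * Real.logb 2 L))) := by
        gcongr
        exact min_le_right _ _
      calc Real.logb 2 L * (2 * (P * q))
          ≤ Real.logb 2 L * (2 * (n * ((m : ℝ) / n * (1 / (6 * Real.logb 2 L))))) := by
            refine mul_le_mul_of_nonneg_left ?_ hlog.le
            linarith
        _ = m / 3 := by field_simp; norm_num
        _ ≤ m := by linarith
    calc (n.choose q : ℝ) ^ (2 * P) ≤ (L ^ q) ^ (2 * P) := by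
          gcongr
          exact Nat.choose_le_exp_one_mul_div_pow n q hq1
      _ = (2 : ℝ) ^ (Real.logb 2 L * (2 * (P * q))) := by
          rw [Real.rpow_mul zero_le_two, Real.rpow_logb two_pos (by norm_num) (by linarith),
            ← pow_mul, ← Real.rpow_natCast]
          congr 1
          push_cast
          ring
      _ ≤ (2 : ℝ) ^ (m : ℝ) := Real.rpow_le_rpow_of_exponent_le one_le_two hexponent
      _ = 2 ^ m := Real.rpow_natCast 2 m
  have hsquares : (P : ℝ) * q * (3 * q) < n ^ 2 := by
    have h1 : M ≤ n / (3 * q) := min_le_left _ _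
    rw [le_div_iff₀ (by positivity)] at h1
    nlinarith [mul_lt_mul_of_pos_right hPM (by positivity : (0 : ℝ) < 3 * q)]
  have hcount' : ((n : ℝ) ^ 2) ^ m ≤ (2 * ((P : ℝ) * q ^ 2)) ^ m := by
    rw [mul_pow 2]
    calc ((n : ℝ) ^ 2) ^ m ≤ (n.choose q : ℝ) ^ (2 * P) * ((P : ℝ) * q ^ 2) ^ m := by
          exact_mod_cast hcount
      _ ≤ 2 ^ m * ((P : ℝ) * q ^ 2) ^ m := by gcongr
  have hm' : m ≠ 0 := by rintro rfl; simp at hm0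
  have hle := le_of_pow_le_pow_left₀ hm' (by positivity) hcount'
  nlinarith [(by positivity : (0 : ℝ) ≤ P * q ^ 2)]
end

section
/- Suppose m ≥ (2^{3e}/e)·n and 1 ≤ q < n/2, and additionally that either 6q ≤ n²/m or 6q ≥ n²·ln(en/(6q))/m. Then there exists a some-pairs problem f : Fin m → X × Y with n inputs per side and m (possibly repeated) edges such that every mapping schema of reducer size q for f (complete or not) has replication rate r ≥ min( n/(18q), (m/n)·(1/(6·log₂(en/(6q)))) ). -/
open Finset in
/-- The pairs covered by a list of reducers cost at most half of `q` times the total size. -/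
lemma two_mul_card_covered_le {n q : ℕ} (l : List (Finset (Fin n) × Finset (Fin n)))
    (hl : ∀ a ∈ l, #a.1 ≤ q ∧ #a.2 ≤ q) :
    2 * #{x : Fin n × Fin n | ∃ a ∈ l, x.1 ∈ a.1 ∧ x.2 ∈ a.2} ≤
      q * (l.map fun a => #a.1 + #a.2).sum := by
  induction l with
  | nil => simp
  | cons a l ih =>
    have h1 := ih fun b hb => hl b (List.mem_cons_of_mem _ hb)
    obtain ⟨ha1, ha2⟩ := hl a List.mem_cons_self
    have h2 : ({x : Fin n × Fin n | ∃ b ∈ a :: l, x.1 ∈ b.1 ∧ x.2 ∈ b.2} : Finset _) ⊆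
        a.1 ×ˢ a.2 ∪ univ.filter fun x => ∃ b ∈ l, x.1 ∈ b.1 ∧ x.2 ∈ b.2 := by
      intro x
      simp
    have h3 := (card_le_card h2).trans (card_union_le _ _)
    rw [card_product] at h3
    simp only [List.map_cons, List.sum_cons]
    nlinarith [Nat.mul_le_mul_right #a.1 ha2, Nat.mul_le_mul_right #a.2 ha1]

open Finset in
/-- Greedily merging consecutive reducers yields a schema whose number of reducers is controlled
by its total size. -/
lemma exists_merged_schema_s9 {n q : ℕ} (l : List (Finset (Fin n) × Finset (Fin n)))
    (hl : ∀ a ∈ l, #a.1 ≤ q ∧ #a.2 ≤ q) :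
    ∃ (h : Finset (Fin n) × Finset (Fin n)) (t : List (Finset (Fin n) × Finset (Fin n))),
      (∀ a ∈ h :: t, #a.1 ≤ q ∧ #a.2 ≤ q) ∧
      (∀ a ∈ l, ∃ b ∈ h :: t, a.1 ⊆ b.1 ∧ a.2 ⊆ b.2) ∧
      ((h :: t).map fun a => #a.1 + #a.2).sum ≤ (l.map fun a => #a.1 + #a.2).sum ∧
      q * t.length ≤ #h.1 + #h.2 + 2 * (t.map fun a => #a.1 + #a.2).sum := by
  induction l with
  | nil => exact ⟨(∅, ∅), [], by simp⟩
  | cons a l ih =>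
    obtain ⟨h, t, hb, hc, hw, hlen⟩ := ih fun b hb => hl b (List.mem_cons_of_mem _ hb)
    have ha := hl a List.mem_cons_self
    simp only [List.map_cons, List.sum_cons] at hw
    by_cases hm : #(a.1 ∪ h.1) ≤ q ∧ #(a.2 ∪ h.2) ≤ q
    · refine ⟨(a.1 ∪ h.1, a.2 ∪ h.2), t, ?_, ?_, ?_, ?_⟩
      · intro b hb'
        rcases List.mem_cons.1 hb' with rfl | hb'
        · exact hm
        · exact hb b (List.mem_cons_of_mem _ hb')
      · intro b hb'
        rcases List.mem_cons.1 hb' with rfl | hb'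
        · exact ⟨_, List.mem_cons_self, subset_union_left, subset_union_left⟩
        · obtain ⟨c, hc1, hc2, hc3⟩ := hc b hb'
          rcases List.mem_cons.1 hc1 with rfl | hc1
          · exact ⟨_, List.mem_cons_self, hc2.trans subset_union_right,
              hc3.trans subset_union_right⟩
          · exact ⟨c, List.mem_cons_of_mem _ hc1, hc2, hc3⟩
      · simp only [List.map_cons, List.sum_cons]
        have := card_union_le a.1 h.1
        have := card_union_le a.2 h.2
        omega
      · have : #h.1 ≤ #(a.1 ∪ h.1) := card_le_card subset_union_right
        have : #h.2 ≤ #(a.2 ∪ h.2) := card_le_card subset_union_right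
        simp only
        omega
    · refine ⟨a, h :: t, ?_, ?_, ?_, ?_⟩
      · intro b hb'
        rcases List.mem_cons.1 hb' with rfl | hb'
        · exact ha
        · exact hb b hb'
      · intro b hb'
        rcases List.mem_cons.1 hb' with rfl | hb'
        · exact ⟨_, List.mem_cons_self, subset_rfl, subset_rfl⟩
        · obtain ⟨c, hc1, hc2⟩ := hc b hb'
          exact ⟨c, List.mem_cons_of_mem _ hc1, hc2⟩
      · simp only [List.map_cons, List.sum_cons]
        omega
      · simp only [List.map_cons, List.sum_cons, List.length_cons, mul_add, mul_one]
        have := card_union_le a.1 h.1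
        have := card_union_le a.2 h.2
        omega

open Finset in
/-- If every problem with `m` edges has a schema of small total size, then counting problems
against merged schemas bounds `18 ^ m`. -/
lemma pow_le_of_forall_exists_schema {n m q P : ℕ} (hn : 0 < n)
    (H : ∀ f : Fin m → Fin n × Fin n, ∃ (p : ℕ) (S T : Fin p → Finset (Fin n)),
      (∀ i, #(S i) ≤ q) ∧ (∀ i, #(T i) ≤ q) ∧
      (∀ j : Fin m, ∃ i, (f j).1 ∈ S i ∧ (f j).2 ∈ T i) ∧
      9 * (q * ∑ i, (#(S i) + #(T i))) ≤ n ^ 2 ∧ 2 * ∑ i, (#(S i) + #(T i)) < q * P) :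
    18 ^ m ≤ (#{A : Finset (Fin n) | #A ≤ q} ^ 2) ^ P := by
  set B : Finset (Finset (Fin n)) := {A : Finset (Fin n) | #A ≤ q} with hB
  let cover (g : Fin P → Finset (Fin n) × Finset (Fin n)) : Finset (Fin n × Fin n) :=
    {x | ∃ i, x.1 ∈ (g i).1 ∧ x.2 ∈ (g i).2}
  let G : Finset (Fin P → Finset (Fin n) × Finset (Fin n)) :=
    {g ∈ Fintype.piFinset fun _ => B ×ˢ B | 18 * #(cover g) ≤ n ^ 2}
  have hsub : (univ : Finset (Fin m → Fin n × Fin n)) ⊆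
      G.biUnion fun g => Fintype.piFinset fun _ => cover g := by
    intro f _
    obtain ⟨p, S, T, hS, hT, hf, hK, hP⟩ := H f
    obtain ⟨h, t, hb, hc, hw, hlen⟩ :=
      exists_merged_schema_s9 (q := q) (List.ofFn fun i => (S i, T i)) (by
        intro a ha
        obtain ⟨i, rfl⟩ := List.mem_ofFn.1 ha
        exact ⟨hS i, hT i⟩)
    have hcov := two_mul_card_covered_le (h :: t) hb
    rw [List.map_ofFn, List.sum_ofFn] at hw
    simp only [Function.comp_def] at hw
    have hlP : t.length < P := by
      simp only [List.map_cons, List.sum_cons] at hw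
      exact lt_of_mul_lt_mul_left (show q * t.length < q * P by omega) (Nat.zero_le q)
    let g : Fin P → Finset (Fin n) × Finset (Fin n) := fun i => ((h :: t)[(i : ℕ)]?).getD (∅, ∅)
    have hg : ∀ i, g i ∈ h :: t ∨ g i = (∅, ∅) := by
      intro i
      rcases lt_or_ge (i : ℕ) (h :: t).length with hi | hi
      · left
        simp only [g, List.getElem?_eq_getElem hi, Option.getD_some]
        exact List.getElem_mem hi
      · right
        simp only [g, List.getElem?_eq_none hi, Option.getD_none]
    refine mem_biUnion.2 ⟨g, mem_filter.2 ⟨?_, ?_⟩, ?_⟩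
    · refine Fintype.mem_piFinset.2 fun i => ?_
      rcases hg i with hi | hi
      · simpa [hB] using hb _ hi
      · simp [hi, hB]
    · have : cover g ⊆ univ.filter fun x => ∃ a ∈ h :: t, x.1 ∈ a.1 ∧ x.2 ∈ a.2 := by
        intro x hx
        obtain ⟨i, hx1, hx2⟩ := (mem_filter.1 hx).2
        rcases hg i with hi | hi
        · exact mem_filter.2 ⟨mem_univ _, g i, hi, hx1, hx2⟩
        · simp [hi] at hx1
      have h1 := card_le_card this
      have h2 := Nat.mul_le_mul_left q hw
      omega
    · refine Fintype.mem_piFinset.2 fun j => mem_filter.2 ⟨mem_univ _, ?_⟩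
      obtain ⟨i, hi1, hi2⟩ := hf j
      obtain ⟨b, hbm, hb1, hb2⟩ := hc (S i, T i) (List.mem_ofFn.2 ⟨i, rfl⟩)
      obtain ⟨k, hk, rfl⟩ := List.getElem_of_mem hbm
      have hkP : k < P := by
        simp only [List.length_cons] at hk
        omega
      refine ⟨⟨k, hkP⟩, ?_⟩
      simp only [g, List.getElem?_eq_getElem hk, Option.getD_some]
      exact ⟨hb1 hi1, hb2 hi2⟩
  have hcount : 18 ^ m * (n ^ 2) ^ m ≤ (#B ^ 2) ^ P * (n ^ 2) ^ m := by
    calc 18 ^ m * (n ^ 2) ^ m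
        = 18 ^ m * #(univ : Finset (Fin m → Fin n × Fin n)) := by
          simp [sq]
      _ ≤ 18 ^ m * ∑ g ∈ G, #(Fintype.piFinset fun _ : Fin m => cover g) :=
          Nat.mul_le_mul_left _ ((card_le_card hsub).trans card_biUnion_le)
      _ = ∑ g ∈ G, (18 * #(cover g)) ^ m := by
          simp [mul_sum, mul_pow]
      _ ≤ ∑ g ∈ G, (n ^ 2) ^ m :=
          sum_le_sum fun g hg => Nat.pow_le_pow_left (mem_filter.1 hg).2 m
      _ = #G * (n ^ 2) ^ m := by simp
      _ ≤ (#B ^ 2) ^ P * (n ^ 2) ^ m := by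
          refine Nat.mul_le_mul_right _ ((card_filter_le _ _).trans ?_)
          simp [sq]
  exact Nat.le_of_mul_le_mul_right hcount (by positivity)

open Finset in
/-- The number of subsets of size at most `q` of an `n`-element set is at most `(en/q)^q`. -/
lemma card_finset_card_le_le {n q : ℕ} (hq : 1 ≤ q) (hqn : q ≤ n) :
    (#{A : Finset (Fin n) | #A ≤ q} : ℝ) ≤ (Real.exp 1 * n / q) ^ q := by
  have hq0 : (0 : ℝ) < q := by exact_mod_cast hq
  have hn0 : (0 : ℝ) < n := by exact_mod_cast hq.trans hqn
  set u : ℝ := q / n with hu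
  have hu0 : 0 < u := by positivity
  have hu1 : u ≤ 1 := by
    rw [hu, div_le_one hn0]
    exact_mod_cast hqn
  have h1 : (#{A : Finset (Fin n) | #A ≤ q} : ℝ) * u ^ q ≤ (1 + u) ^ n := by
    calc (#{A : Finset (Fin n) | #A ≤ q} : ℝ) * u ^ q
        = ∑ A : Finset (Fin n) with #A ≤ q, u ^ q := by simp
      _ ≤ ∑ A : Finset (Fin n) with #A ≤ q, u ^ #A :=
          sum_le_sum fun A hA => pow_le_pow_of_le_one hu0.le hu1 (mem_filter.1 hA).2
      _ ≤ ∑ A : Finset (Fin n), u ^ #A :=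
          sum_le_sum_of_subset_of_nonneg (filter_subset _ _) fun _ _ _ => by positivity
      _ = (1 + u) ^ n := by
          have := Fin.sum_pow_mul_eq_add_pow u 1 (n := n)
          simpa [add_comm] using this
  have h2 : (1 + u) ^ n ≤ Real.exp 1 ^ q := by
    calc (1 + u) ^ n ≤ Real.exp u ^ n := by
          gcongr
          linarith [Real.add_one_le_exp u]
      _ = Real.exp 1 ^ q := by
          rw [← Real.exp_nat_mul, ← Real.exp_nat_mul, hu]
          congr 1
          field_simp
  have h3 : Real.exp 1 * n / q = Real.exp 1 / u := by
    rw [hu]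
    field_simp
  rw [h3, div_pow, le_div_iff₀ (by positivity)]
  exact h1.trans h2

open Finset in
/-- The diagonal problem, which touches every input, has replication rate at least one. -/
lemma le_sum_card_of_diagonal {n m p : ℕ} (hn : 0 < n) (hnm : n ≤ m)
    (S T : Fin p → Finset (Fin n))
    (h : ∀ j : Fin m, ∃ i, (⟨j % n, Nat.mod_lt _ hn⟩ : Fin n) ∈ S i ∧
      (⟨j % n, Nat.mod_lt _ hn⟩ : Fin n) ∈ T i) :
    2 * n ≤ ∑ i, (#(S i) + #(T i)) := by
  have key : ∀ x : Fin n, ∃ i, x ∈ S i ∧ x ∈ T i := by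
    intro x
    simpa [Nat.mod_eq_of_lt x.2] using h ⟨x, x.2.trans_le hnm⟩
  have hU : ∀ U : Fin p → Finset (Fin n), (∀ x, ∃ i, x ∈ U i) → n ≤ ∑ i, #(U i) := by
    intro U hU
    calc n = #(univ : Finset (Fin n)) := by simp
      _ ≤ #(univ.biUnion U) := card_le_card fun x _ => by simpa using hU x
      _ ≤ ∑ i, #(U i) := card_biUnion_le
  have h1 := hU S fun x => (key x).imp fun _ => And.left
  have h2 := hU T fun x => (key x).imp fun _ => And.right
  rw [sum_add_distrib]
  omega

/-- The numerical estimate behind the comparison of the two counts. -/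
lemma log_eighteen_gt :
    4 / 3 * Real.log 2 * (1 + Real.log 6) + 1 / 10 < Real.log 18 := by
  have h2 := Real.log_two_gt_d9
  have h2' := Real.log_two_lt_d9
  have e6 : Real.log 6 = Real.log 2 + Real.log 3 := by
    rw [← Real.log_mul (by norm_num) (by norm_num)]
    norm_num
  have e18 : Real.log 18 = Real.log 2 + 2 * Real.log 3 := by
    rw [show (18 : ℝ) = 2 * 3 ^ 2 by norm_num, Real.log_mul (by norm_num) (by norm_num),
      Real.log_pow]
    norm_num
  have a : 19 * Real.log 2 ≤ 12 * Real.log 3 := by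
    have := Real.log_le_log (by norm_num) (show (2 : ℝ) ^ 19 ≤ 3 ^ 12 by norm_num)
    rw [Real.log_pow, Real.log_pow] at this
    exact_mod_cast this
  have b : 5 * Real.log 3 ≤ 8 * Real.log 2 := by
    have := Real.log_le_log (by norm_num) (show (3 : ℝ) ^ 5 ≤ 2 ^ 8 by norm_num)
    rw [Real.log_pow, Real.log_pow] at this
    exact_mod_cast this
  rw [e6, e18]
  nlinarith

lemma eighty_le_two_rpow_div : (80 : ℝ) ≤ (2 : ℝ) ^ (3 * Real.exp 1) / Real.exp 1 := by
  have h1 := Real.exp_one_gt_d9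
  have h2 := Real.exp_one_lt_d9
  have h3 : (2 : ℝ) ^ (8 : ℝ) ≤ 2 ^ (3 * Real.exp 1) :=
    Real.rpow_le_rpow_of_exponent_le (by norm_num) (by linarith)
  rw [le_div_iff₀ (by positivity)]
  norm_num at h3
  linarith


/-- Under the stated conditions on `n`, `m`, `q`, there exists a some-pairs
problem `f : Fin m → Fin n × Fin n` such that every mapping schema of reducer size `q`
for `f` (complete or not) has replication rate at least
`min( n/(18q), (m/n)·(1/(6·log₂(en/(6q)))) )`. -/
theorem some_pairs_lower_bound_all (n m q : ℕ)
    (hm : (m : ℝ) ≥ (2 : ℝ) ^ (3 * Real.exp 1) / Real.exp 1 * n)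
    (hq1 : 1 ≤ q) (hqn : 2 * q < n)
    (hcase : (6 * q : ℝ) ≤ (n : ℝ) ^ 2 / m ∨
      (6 * q : ℝ) ≥ (n : ℝ) ^ 2 * Real.log (Real.exp 1 * n / (6 * q)) / m) :
    ∃ f : Fin m → Fin n × Fin n,
      ∀ (p : ℕ) (S T : Fin p → Finset (Fin n)),
        (∀ i, (S i).card ≤ q) → (∀ i, (T i).card ≤ q) →
        (∀ j : Fin m, ∃ i, (f j).1 ∈ S i ∧ (f j).2 ∈ T i) →
        (∑ i, ((S i).card + (T i).card : ℝ)) / (2 * n) ≥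
          min ((n : ℝ) / (18 * q))
              ((m : ℝ) / n * (1 / (6 * Real.logb 2 (Real.exp 1 * n / (6 * q))))) := by
  have hn : 0 < n := by omega
  have hn0 : (0 : ℝ) < n := by exact_mod_cast hn
  have hq0 : (0 : ℝ) < q := by exact_mod_cast hq1
  have hm80 : 80 * (n : ℝ) ≤ m :=
    (mul_le_mul_of_nonneg_right eighty_le_two_rpow_div hn0.le).trans hm
  rcases le_or_gt n (6 * q) with h6 | h6
  · refine ⟨fun j => (⟨j % n, Nat.mod_lt _ hn⟩, ⟨j % n, Nat.mod_lt _ hn⟩), ?_⟩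
    intro p S T _ _ hc
    have hnm : n ≤ m := by
      have : (n : ℝ) ≤ m := by linarith
      exact_mod_cast this
    have h1 : (2 * n : ℝ) ≤ ∑ i, ((S i).card + (T i).card : ℝ) := by
      exact_mod_cast le_sum_card_of_diagonal hn hnm S T hc
    refine (min_le_left _ _).trans (le_trans ?_ ((one_le_div (by positivity)).2 h1))
    have : (n : ℝ) ≤ 6 * q := by exact_mod_cast h6
    rw [div_le_one (by positivity)]
    linarith
  · by_contra! hcon
    have h6' : (6 * q : ℝ) < n := by exact_mod_cast h6
    set l : ℝ := Real.log (Real.exp 1 * n / (6 * q)) with hl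
    have hl1 : 1 ≤ l := by
      rw [hl, Real.le_log_iff_exp_le (by positivity), le_div_iff₀ (by positivity)]
      exact mul_le_mul_of_nonneg_left h6'.le (Real.exp_pos 1).le
    have hlog2 : 0 < Real.log 2 := Real.log_pos (by norm_num)
    set R : ℝ := min ((n : ℝ) / (18 * q))
      ((m : ℝ) / n * (1 / (6 * Real.logb 2 (Real.exp 1 * n / (6 * q))))) with hR
    have hR1 : 18 * q * R ≤ n := by
      have : R ≤ (n : ℝ) / (18 * q) := min_le_left _ _
      rw [le_div_iff₀ (by positivity)] at this
      linarith
    have hR2 : 6 * n * l * R ≤ m * Real.log 2 := by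
      have h : R ≤ _ := min_le_right _ _
      have e : (m : ℝ) / n * (1 / (6 * Real.logb 2 (Real.exp 1 * n / (6 * q)))) =
          m * Real.log 2 / (6 * n * l) := by
        rw [Real.logb, ← hl]
        field_simp
      rw [e, le_div_iff₀ (by positivity)] at h
      linarith
    have hR0 : 0 ≤ R := by
      refine le_min (by positivity) ?_
      rw [Real.logb, ← hl]
      positivity
    set P : ℕ := ⌊4 * n * R / q⌋₊ + 1 with hP
    have hP1 : 4 * n * R < q * P := by
      have := Nat.lt_floor_add_one (4 * n * R / q)
      rw [div_lt_iff₀ hq0] at this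
      rw [hP]
      push_cast
      linarith
    have hP2 : q * P ≤ 4 * n * R + q := by
      have := Nat.floor_le (show 0 ≤ 4 * n * R / q by positivity)
      rw [le_div_iff₀ hq0] at this
      rw [hP]
      push_cast
      linarith
    have hcount : 18 ^ m ≤
        ((Finset.univ.filter fun A : Finset (Fin n) => A.card ≤ q).card ^ 2) ^ P := by
      refine pow_le_of_forall_exists_schema hn fun f => ?_
      obtain ⟨p, S, T, hS, hT, hc, hw⟩ := hcon f
      rw [div_lt_iff₀ (by positivity)] at hw
      refine ⟨p, S, T, hS, hT, hc, ?_, ?_⟩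
      · have : (9 * (q * ∑ i, ((S i).card + (T i).card : ℝ))) ≤ (n : ℝ) ^ 2 := by
          nlinarith [mul_le_mul_of_nonneg_left hw.le hq0.le, mul_le_mul_of_nonneg_left hR1 hn0.le]
        exact_mod_cast this
      · have : 2 * ∑ i, ((S i).card + (T i).card : ℝ) < q * P := by linarith
        exact_mod_cast this
    have hB := card_finset_card_le_le hq1 (show q ≤ n by omega)
    set y : ℝ := Real.exp 1 * n / q with hy
    have hy0 : 0 < y := by positivity
    have hreal : (18 : ℝ) ^ m ≤ y ^ (2 * (q * P)) := by
      calc (18 : ℝ) ^ m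
          ≤ (((Finset.univ.filter fun A : Finset (Fin n) => A.card ≤ q).card : ℝ) ^ 2) ^ P := by
            exact_mod_cast hcount
        _ ≤ ((y ^ q) ^ 2) ^ P := by gcongr
        _ = y ^ (2 * (q * P)) := by
            rw [← pow_mul, ← pow_mul]
            congr 1
            ring
    have hlogs := Real.log_le_log (by positivity) hreal
    rw [Real.log_pow, Real.log_pow] at hlogs
    push_cast at hlogs
    have hly : Real.log y = l + Real.log 6 := by
      rw [hl, ← Real.log_mul (by positivity) (by norm_num), hy]
      congr 1
      field_simp
    have hl6 : 0 < Real.log 6 := Real.log_pos (by norm_num)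
    have hqy : q * Real.log y ≤ n := by
      have h1 : Real.log y = 1 + Real.log (n / q) := by
        rw [hy, mul_div_assoc, Real.log_mul (by positivity) (by positivity), Real.log_exp]
      have h2 := Real.log_le_sub_one_of_pos (show (0 : ℝ) < n / q by positivity)
      have h3 : Real.log y ≤ n / q := by linarith
      rw [le_div_iff₀ hq0] at h3
      linarith
    have hly0 : 0 ≤ Real.log y := by linarith
    have hnR : 0 ≤ n * R := by positivity
    have hmain : n * R * Real.log y ≤ m * Real.log 2 * (1 + Real.log 6) / 6 := by
      have h1 : Real.log y ≤ l * (1 + Real.log 6) := by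
        rw [hly]
        nlinarith
      nlinarith [mul_le_mul_of_nonneg_left h1 hnR,
        mul_le_mul_of_nonneg_right hR2 (show 0 ≤ 1 + Real.log 6 by linarith)]
    have hupper := mul_le_mul_of_nonneg_right hP2 hly0
    have hm0 : (0 : ℝ) < m := by linarith
    nlinarith [mul_lt_mul_of_pos_left log_eighteen_gt hm0]
end

section
/- Let q ≥ 1 and n = q·2^i for some natural number i ≥ 0. Then every some-pairs problem E with n inputs per side and m = |E| outputs has a mapping schema of reducer size q whose replication rate is at most √(m/q). -/
theorem card_filter_val_div_eq_le {n q : ℕ} (hq : 1 ≤ q) (a : ℕ) :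
    (Finset.univ.filter fun x : Fin n => x.val / q = a).card ≤ q := by
  calc (Finset.univ.filter fun x : Fin n => x.val / q = a).card
      ≤ (Finset.Ico (a * q) (a * q + q)).card := by
        refine Finset.card_le_card_of_injOn Fin.val (fun x hx => ?_)
          Fin.val_injective.injOn
        have hx : x.val / q = a := by simpa using hx
        have h := (Nat.div_eq_iff (by omega)).1 hx
        simp only [Finset.coe_Ico, Set.mem_Ico]
        omega
    _ = q := by simp

/-- A mapping schema indexed by any finite type, with all parts of size at most `c` and
`|ι| * c / n ≤ B`, yields one indexed by some `Fin p` with replication rate at most `B`. -/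
theorem exists_mapping_schema_of_fintype {ι : Type*} [Fintype ι] {n q c : ℕ} (hcq : c ≤ q)
    (E : Finset (Fin n × Fin n)) (S T : ι → Finset (Fin n))
    (hS : ∀ k, (S k).card ≤ c) (hT : ∀ k, (T k).card ≤ c)
    (hE : ∀ e ∈ E, ∃ k, e.1 ∈ S k ∧ e.2 ∈ T k) {B : ℝ}
    (hB : (Fintype.card ι * c : ℝ) / n ≤ B) :
    ∃ (p : ℕ) (S T : Fin p → Finset (Fin n)),
      (∀ k, (S k).card ≤ q) ∧ (∀ k, (T k).card ≤ q) ∧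
      (∀ e ∈ E, ∃ k, e.1 ∈ S k ∧ e.2 ∈ T k) ∧
      (∑ k, ((S k).card + (T k).card : ℝ)) / (2 * n) ≤ B := by
  let f := (Fintype.equivFin ι).symm
  refine ⟨Fintype.card ι, S ∘ f, T ∘ f, fun k => (hS _).trans hcq,
    fun k => (hT _).trans hcq, fun e he => ?_, le_trans ?_ hB⟩
  · obtain ⟨k, hk⟩ := hE e he
    exact ⟨f.symm k, by simpa using hk⟩
  · have hsum : (∑ k, (((S ∘ f) k).card + ((T ∘ f) k).card : ℝ)) ≤
        2 * (Fintype.card ι * c) := by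
      calc _ ≤ ∑ _k : Fin (Fintype.card ι), (2 * c : ℝ) := by
            refine Finset.sum_le_sum fun k _ => ?_
            have h1 : ((S (f k)).card : ℝ) ≤ c := by exact_mod_cast hS _
            have h2 : ((T (f k)).card : ℝ) ≤ c := by exact_mod_cast hT _
            simp only [Function.comp_apply]
            linarith
        _ = _ := by simp; ring
    calc _ ≤ (2 * (Fintype.card ι * c) : ℝ) / (2 * n) := by gcongr
      _ = _ := mul_div_mul_left _ _ two_ne_zero

/-- Algorithm C: If `q ≥ 1` and `n = q·2^i`, then every some-pairs
problem `E` with `n` inputs per side and `m` outputs has a mapping schema of reducer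
size `q` with replication rate at most `√(m/q)`. -/
theorem algorithm_C_replication (q i n : ℕ) (hq : 1 ≤ q) (hn : n = q * 2 ^ i)
    (E : Finset (Fin n × Fin n)) (m : ℕ) (hm : E.card = m) :
    ∃ (p : ℕ) (S T : Fin p → Finset (Fin n)),
      (∀ k, (S k).card ≤ q) ∧ (∀ k, (T k).card ≤ q) ∧
      (∀ e ∈ E, ∃ k, e.1 ∈ S k ∧ e.2 ∈ T k) ∧
      (∑ k, ((S k).card + (T k).card : ℝ)) / (2 * n) ≤ Real.sqrt ((m : ℝ) / q) := by
  have hq' : (0 : ℝ) < q := by exact_mod_cast hq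
  have hnR : (n : ℝ) = q * 2 ^ i := by rw [hn]; push_cast; rfl
  rcases le_total (m : ℝ) (q * (2 ^ i) ^ 2) with h | h
  · -- Few edges: one reducer per edge.
    refine exists_mapping_schema_of_fintype (ι := E) (c := 1) hq E
      (fun e => {e.1.1}) (fun e => {e.1.2}) (by simp) (by simp)
      (fun e he => ⟨⟨e, he⟩, by simp⟩) (Real.le_sqrt_of_sq_le ?_)
    rw [Fintype.card_coe, hm, hnR, Nat.cast_one, mul_one, div_pow,
      div_le_div_iff₀ (by positivity) hq']
    calc (m : ℝ) ^ 2 * q = m * q * m := by ring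
      _ ≤ m * q * (q * (2 ^ i) ^ 2) := by gcongr
      _ = m * (q * 2 ^ i) ^ 2 := by ring
  · -- Many edges: cover everything by a grid of `q × q` blocks.
    refine exists_mapping_schema_of_fintype (ι := Fin (2 ^ i) × Fin (2 ^ i)) le_rfl E
      (fun k => Finset.univ.filter fun x => x.val / q = k.1.val)
      (fun k => Finset.univ.filter fun x => x.val / q = k.2.val)
      (fun _ => card_filter_val_div_eq_le hq _) (fun _ => card_filter_val_div_eq_le hq _)
      (fun e _ => ?_) (Real.le_sqrt_of_sq_le ?_)
    · have hlt (x : Fin n) : x.val / q < 2 ^ i :=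
        Nat.div_lt_of_lt_mul (hn ▸ x.isLt)
      exact ⟨(⟨_, hlt e.1⟩, ⟨_, hlt e.2⟩), by simp⟩
    · have hrate : ((Fintype.card (Fin (2 ^ i) × Fin (2 ^ i)) : ℝ) * q) / n = 2 ^ i := by
        rw [hnR, Fintype.card_prod, Fintype.card_fin]
        push_cast
        field_simp
      rw [hrate, le_div_iff₀ hq', mul_comm]
      exact h
end

section
/- Let q ≥ 1 and n ≥ q/2. Then every some-pairs problem E with n inputs per side and m = |E| outputs has a mapping schema of reducer size q whose replication rate is at most 2·√(m/q). -/
/-- The block of elements of `Fin n` whose quotient by `q` is `i`. -/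
def finBlock (q n i : ℕ) : Finset (Fin n) := Finset.univ.filter fun x => x.val / q = i

theorem card_finBlock_le {q : ℕ} (hq : 1 ≤ q) (n i : ℕ) : (finBlock q n i).card ≤ q := by
  calc (finBlock q n i).card = ((finBlock q n i).map Fin.valEmbedding).card :=
        (Finset.card_map _).symm
    _ ≤ (Finset.Ico (i * q) (i * q + q)).card := by
        refine Finset.card_le_card fun x hx => ?_
        simp only [finBlock, Finset.mem_map, Finset.mem_filter, Finset.mem_univ, true_and,
          Fin.valEmbedding_apply] at hx
        obtain ⟨y, hy, rfl⟩ := hx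
        rw [Nat.div_eq_iff (by omega)] at hy
        rw [Finset.mem_Ico]
        omega
    _ = q := by simp

theorem sum_card_finBlock (q n : ℕ) :
    ∑ i : Fin (n / q + 1), (finBlock q n i).card = n := by
  have h := Finset.card_eq_sum_card_fiberwise (s := (Finset.univ : Finset (Fin n)))
    (t := (Finset.univ : Finset (Fin (n / q + 1))))
    (f := fun x => ⟨x.val / q, Nat.lt_succ_of_le (Nat.div_le_div_right x.isLt.le)⟩)
    (fun _ _ => Finset.mem_coe.2 (Finset.mem_univ _))
  simpa [Fin.ext_iff, finBlock] using h.symm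

/-- A mapping schema indexed by a finite type can be reindexed by `Fin p`. -/
theorem exists_fin_schema_of_fintype {ι : Type*} [Fintype ι] {q n : ℕ}
    {E : Finset (Fin n × Fin n)} {c : ℝ} (S T : ι → Finset (Fin n))
    (hS : ∀ k, (S k).card ≤ q) (hT : ∀ k, (T k).card ≤ q)
    (hE : ∀ e ∈ E, ∃ k, e.1 ∈ S k ∧ e.2 ∈ T k)
    (hc : (∑ k, ((S k).card + (T k).card : ℝ)) / (2 * n) ≤ c) :
    ∃ (p : ℕ) (S T : Fin p → Finset (Fin n)),
      (∀ k, (S k).card ≤ q) ∧ (∀ k, (T k).card ≤ q) ∧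
      (∀ e ∈ E, ∃ k, e.1 ∈ S k ∧ e.2 ∈ T k) ∧
      (∑ k, ((S k).card + (T k).card : ℝ)) / (2 * n) ≤ c := by
  let f := (Fintype.equivFin ι).symm
  refine ⟨Fintype.card ι, S ∘ f, T ∘ f, fun k => hS _, fun k => hT _, fun e he => ?_, ?_⟩
  · obtain ⟨k, hk⟩ := hE e he
    exact ⟨f.symm k, by simpa using hk⟩
  · simpa only [Function.comp_apply,
      f.sum_comp fun k => ((S k).card + (T k).card : ℝ)] using hc

/-- Algorithm C, general `n`: If `q ≥ 1` and `n ≥ q/2`, then every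
some-pairs problem `E` with `n` inputs per side and `m` outputs has a mapping schema of
reducer size `q` with replication rate at most `2·√(m/q)`. -/
theorem algorithm_C_replication_general (q n : ℕ) (hq : 1 ≤ q) (hn : 2 * n ≥ q)
    (E : Finset (Fin n × Fin n)) (m : ℕ) (hm : E.card = m) :
    ∃ (p : ℕ) (S T : Fin p → Finset (Fin n)),
      (∀ k, (S k).card ≤ q) ∧ (∀ k, (T k).card ≤ q) ∧
      (∀ e ∈ E, ∃ k, e.1 ∈ S k ∧ e.2 ∈ T k) ∧
      (∑ k, ((S k).card + (T k).card : ℝ)) / (2 * n) ≤ 2 * Real.sqrt ((m : ℝ) / q) := by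
  have hq0 : (0 : ℝ) < q := by exact_mod_cast hq
  have hn0 : (0 : ℝ) < n := by exact_mod_cast (by omega : 0 < n)
  have hqn : (q : ℝ) ≤ 2 * n := by exact_mod_cast hn
  by_cases hcase : (m : ℝ) * q ≤ 4 * n ^ 2
  · -- Few edges: one reducer per edge.
    refine exists_fin_schema_of_fintype (ι := E) (fun e => {e.1.1}) (fun e => {e.1.2})
      (by simp [hq]) (by simp [hq]) (fun e he => ⟨⟨e, he⟩, by simp⟩) ?_
    have hsum : ∑ e : E, ((({e.1.1} : Finset (Fin n)).card : ℝ) +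
        (({e.1.2} : Finset (Fin n)).card : ℝ)) = 2 * m := by
      simp [hm]
      ring
    rw [hsum, mul_div_mul_left _ _ two_ne_zero]
    have h : (m : ℝ) / n / 2 ≤ Real.sqrt ((m : ℝ) / q) := by
      apply Real.le_sqrt_of_sq_le
      rw [div_div, div_pow, div_le_div_iff₀ (by positivity) hq0]
      nlinarith [mul_le_mul_of_nonneg_left hcase (Nat.cast_nonneg (α := ℝ) m)]
    linarith
  · -- Many edges: one reducer per pair of blocks.
    push Not at hcase
    refine exists_fin_schema_of_fintype (ι := Fin (n / q + 1) × Fin (n / q + 1))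
      (fun k => finBlock q n k.1) (fun k => finBlock q n k.2)
      (fun k => card_finBlock_le hq n _) (fun k => card_finBlock_le hq n _)
      (fun e _ => ⟨(⟨e.1.val / q, Nat.lt_succ_of_le (Nat.div_le_div_right e.1.isLt.le)⟩,
        ⟨e.2.val / q, Nat.lt_succ_of_le (Nat.div_le_div_right e.2.isLt.le)⟩),
        by simp [finBlock]⟩) ?_
    have hblocks : ∑ i : Fin (n / q + 1), ((finBlock q n i).card : ℝ) = n := by
      exact_mod_cast sum_card_finBlock q n
    have hsum : ∑ k : Fin (n / q + 1) × Fin (n / q + 1),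
        (((finBlock q n k.1).card : ℝ) + ((finBlock q n k.2).card : ℝ)) =
        ((n / q : ℕ) + 1) * (2 * n) := by
      rw [Fintype.sum_prod_type]
      simp only [Finset.sum_add_distrib, hblocks, Finset.sum_const, Finset.card_univ,
        Fintype.card_fin, nsmul_eq_mul, ← Finset.mul_sum]
      push_cast
      ring
    rw [hsum, mul_div_cancel_right₀ _ (by positivity)]
    have hfloor : ((n / q : ℕ) : ℝ) ≤ n / q := Nat.cast_div_le
    have hone : (1 : ℝ) ≤ 2 * (n / q) := by
      rw [← mul_div_assoc, le_div_iff₀ hq0]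
      linarith
    have h : 2 * ((n : ℝ) / q) ≤ Real.sqrt ((m : ℝ) / q) := by
      apply Real.le_sqrt_of_sq_le
      rw [← mul_div_assoc, div_pow, div_le_div_iff₀ (by positivity) hq0]
      nlinarith [mul_le_mul_of_nonneg_left hcase.le hq0.le]
    linarith
end

section
/- (Algorithm A.) Let q ≥ 1 divide n. Then there is a family of p = (n/q)² pairs (S_i, T_i) with S_i ⊆ X, T_i ⊆ Y, |S_i| = |T_i| = q, such that for every pair (x,y) ∈ X × Y some i has x ∈ S_i and y ∈ T_i, and every input of X and every input of Y belongs to exactly n/q of the reducers. Consequently, every some-pairs problem E ⊆ X × Y with n inputs per side has a mapping schema of reducer size q with replication rate exactly n/q. -/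
/-- Under an equivalence `ι ≃ α × β`, each fiber of the first coordinate has `|β|` elements. -/
theorem card_filter_fst_equiv_eq {ι α β : Type*} [Fintype ι] [Fintype β] [DecidableEq α]
    (e : ι ≃ α × β) (a : α) :
    (Finset.univ.filter (fun i => (e i).1 = a)).card = Fintype.card β := by
  have h : (Finset.univ.filter fun i => (e i).1 = a) =
      Finset.univ.map ((Function.Embedding.sectR a β).trans e.symm.toEmbedding) := by
    ext i
    obtain ⟨⟨a', c⟩, rfl⟩ := e.symm.surjective i
    simp [eq_comm]
  rw [h, Finset.card_map, Finset.card_univ]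

/-- Algorithm A: If `q ≥ 1` divides `n`, there is a family of
`p = (n/q)²` reducers `(Sᵢ, Tᵢ)` with `|Sᵢ| = |Tᵢ| = q` covering every pair of
`X × Y`, with every input belonging to exactly `n/q` reducers; consequently every
some-pairs problem `E` with `n` inputs per side has a mapping schema of reducer size `q`
with replication rate exactly `n/q`. -/
theorem algorithm_A (n q : ℕ) (hq : 1 ≤ q) (hdvd : q ∣ n) :
    ∃ S T : Fin ((n / q) ^ 2) → Finset (Fin n),
      (∀ i, (S i).card = q) ∧ (∀ i, (T i).card = q) ∧
      (∀ x y : Fin n, ∃ i, x ∈ S i ∧ y ∈ T i) ∧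
      (∀ x : Fin n, (Finset.univ.filter (fun i => x ∈ S i)).card = n / q) ∧
      (∀ y : Fin n, (Finset.univ.filter (fun i => y ∈ T i)).card = n / q) ∧
      (∀ E : Finset (Fin n × Fin n), ∀ e ∈ E, ∃ i, e.1 ∈ S i ∧ e.2 ∈ T i) ∧
      (∑ i, ((S i).card + (T i).card : ℝ)) / (2 * n) = (n : ℝ) / q := by
  obtain ⟨k, rfl⟩ := hdvd
  rw [Nat.mul_div_cancel_left k hq, Nat.mul_comm q k]
  let b : Fin (k * q) → Fin k := fun x => (finProdFinEquiv.symm x).1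
  have hb : ∀ j, (Finset.univ.filter fun x => b x = j).card = q := fun j =>
    (card_filter_fst_equiv_eq finProdFinEquiv.symm j).trans (Fintype.card_fin q)
  let e : Fin (k ^ 2) ≃ Fin k × Fin k := (finCongr (sq k)).trans finProdFinEquiv.symm
  have hcover : ∀ x y, ∃ i, b x = (e i).1 ∧ b y = (e i).2 := fun x y =>
    ⟨e.symm (b x, b y), by simp⟩
  refine ⟨fun i => Finset.univ.filter fun x => b x = (e i).1,
    fun i => Finset.univ.filter fun y => b y = (e i).2,
    fun i => hb _, fun i => hb _, by simpa using hcover, fun x => ?_, fun y => ?_,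
    fun E p _ => by simpa using hcover p.1 p.2, ?_⟩
  · simpa [eq_comm] using card_filter_fst_equiv_eq e (b x)
  · simp only [Finset.mem_filter_univ, eq_comm (a := b y)]
    exact (card_filter_fst_equiv_eq (e.trans (Equiv.prodComm _ _)) (b y)).trans
      (Fintype.card_fin k)
  · simp only [hb]
    have hq0 : (q : ℝ) ≠ 0 := by positivity
    rcases Nat.eq_zero_or_pos k with rfl | hk
    · simp
    · have hk0 : (k : ℝ) ≠ 0 := by positivity
      simp only [Finset.sum_const, Finset.card_univ, Fintype.card_fin, nsmul_eq_mul]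
      push_cast
      field_simp
      ring
end

section
/- For every q ≥ 1 and every pair of sets S, T ⊆ {0,1}^b with |S| ≤ q and |T| ≤ q, the number of pairs (x,y) ∈ S × T such that x and y differ in exactly one bit (Hamming distance exactly 1) is at most q·log₂(2q). -/
lemma mul_log_two_le_log_one_add {r : ℝ} (h0 : 0 ≤ r) (h1 : r ≤ 1) :
    r * Real.log 2 ≤ Real.log (1 + r) := by
  have h := rpow_one_add_le_one_add_mul_self (s := 1) (by norm_num) h0 h1
  rw [← Real.log_rpow (by norm_num)]
  apply Real.log_le_log (by positivity)
  norm_num at h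
  linarith

/-- A form of the lower bound `2 * p ≤ H p` on binary entropy for `p ≤ 1 / 2`. -/
lemma mul_log_add_mul_log_add_le {x y : ℝ} (hx : 0 ≤ x) (hxy : x ≤ y) :
    x * Real.log x + y * Real.log y + 2 * x * Real.log 2 ≤ (x + y) * Real.log (x + y) := by
  rcases hx.eq_or_lt with rfl | hx
  · simp
  have hy : 0 < y := hx.trans_le hxy
  have h1 : Real.log 2 + Real.log x ≤ Real.log (x + y) := by
    rw [← Real.log_mul (by norm_num) hx.ne']
    exact Real.log_le_log (by positivity) (by linarith)
  have h2 := mul_log_two_le_log_one_add (div_nonneg hx.le hy.le) ((div_le_one hy).2 hxy)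
  have h3 : 1 + x / y = (x + y) / y := by field_simp; ring
  rw [h3, Real.log_div (by positivity) hy.ne'] at h2
  have h4 := mul_le_mul_of_nonneg_left h2 hy.le
  have h5 : y * (x / y * Real.log 2) = x * Real.log 2 := by field_simp
  rw [h5] at h4
  nlinarith [mul_le_mul_of_nonneg_left h1 hx.le]

lemma mul_log_add_mul_log_add_min_le {x y : ℝ} (hx : 0 ≤ x) (hy : 0 ≤ y) :
    x * Real.log x + y * Real.log y + 2 * min x y * Real.log 2
      ≤ (x + y) * Real.log (x + y) := by
  rcases le_total x y with h | h
  · rw [min_eq_left h]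
    exact mul_log_add_mul_log_add_le hx h
  · rw [min_eq_right h, add_comm x y, add_comm (x * _)]
    exact mul_log_add_mul_log_add_le hy h

section HammingOnePairs

variable {ι : Type*} [Fintype ι]

lemma eq_of_hammingDist_eq_one {x y : ι → Bool} (h : hammingDist x y = 1) {i j : ι}
    (hi : x i ≠ y i) (hj : j ≠ i) : x j = y j := by
  by_contra hne
  exact hj (Finset.card_le_one.1 (show (Finset.univ.filter fun k => x k ≠ y k).card ≤ 1 from h.le)
    j (by simpa using hne) i (by simpa using hi))

/-- The pairs in `S × T` at Hamming distance one. -/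
def hammingOnePairs (S T : Finset (ι → Bool)) : Finset ((ι → Bool) × (ι → Bool)) :=
  (S ×ˢ T).filter fun p => hammingDist p.1 p.2 = 1

lemma mem_hammingOnePairs {S T : Finset (ι → Bool)} {p : (ι → Bool) × (ι → Bool)} :
    p ∈ hammingOnePairs S T ↔ (p.1 ∈ S ∧ p.2 ∈ T) ∧ hammingDist p.1 p.2 = 1 := by
  simp [hammingOnePairs]

lemma card_hammingOnePairs_le_min {S T : Finset (ι → Bool)} (i : ι) (c : Bool)
    (hS : ∀ x ∈ S, x i = c) (hT : ∀ y ∈ T, y i = !c) :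
    (hammingOnePairs S T).card ≤ min S.card T.card := by
  have hne : ∀ p ∈ hammingOnePairs S T, p.1 i ≠ p.2 i := fun p hp => by
    rw [mem_hammingOnePairs] at hp
    rw [hS _ hp.1.1, hT _ hp.1.2]
    cases c <;> simp
  refine le_min (Finset.card_le_card_of_injOn Prod.fst
      (fun p hp => (mem_hammingOnePairs.1 hp).1.1) ?_)
    (Finset.card_le_card_of_injOn Prod.snd (fun p hp => (mem_hammingOnePairs.1 hp).1.2) ?_)
  all_goals
    intro p hp p' hp' hpp
    have h := mem_hammingOnePairs.1 hp
    have h' := mem_hammingOnePairs.1 hp'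
    have e := fun j => eq_of_hammingDist_eq_one h.2 (hne p hp) (j := j)
    have e' := fun j => eq_of_hammingDist_eq_one h'.2 (hne p' hp') (j := j)
    refine Prod.ext ?_ ?_ <;> first | exact hpp | skip
    funext j
    by_cases hj : j = i
    · subst hj
      first
      | rw [hT _ h.1.2, hT _ h'.1.2]
      | rw [hS _ h.1.1, hS _ h'.1.1]
    · have := congrFun hpp j
      have := e j hj
      have := e' j hj
      simp_all

lemma card_hammingOnePairs_le_split (S T : Finset (ι → Bool)) (i : ι) :
    (hammingOnePairs S T).card ≤
      (hammingOnePairs (S.filter (· i = false)) (T.filter (· i = false))).card +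
      (hammingOnePairs (S.filter (· i = true)) (T.filter (· i = true))).card +
      ((hammingOnePairs (S.filter (· i = false)) (T.filter (· i = true))).card +
      (hammingOnePairs (S.filter (· i = true)) (T.filter (· i = false))).card) := by
  classical
  refine le_trans (Finset.card_le_card ?_) ((Finset.card_union_le _ _).trans
    (add_le_add (Finset.card_union_le _ _) (Finset.card_union_le _ _)))
  intro p hp
  simp only [Finset.mem_union, mem_hammingOnePairs, Finset.mem_filter] at hp ⊢
  cases p.1 i <;> cases p.2 i <;> simp [hp]

lemma card_hammingOnePairs_mul_log_two_le (K : Finset ι) (S T : Finset (ι → Bool))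
    (hK : ∀ x ∈ S, ∀ y ∈ T, ∀ j ∉ K, x j = y j) :
    2 * ((hammingOnePairs S T).card : ℝ) * Real.log 2
      ≤ (S.card + T.card) * Real.log (S.card + T.card) := by
  classical
  induction K using Finset.induction_on generalizing S T with
  | empty =>
    have h0 : hammingOnePairs S T = ∅ := by
      refine Finset.eq_empty_of_forall_notMem fun p hp => ?_
      obtain ⟨⟨h1, h2⟩, h3⟩ := mem_hammingOnePairs.1 hp
      have : p.1 = p.2 := funext fun j => hK _ h1 _ h2 j (by simp)
      simp [this] at h3
    rw [h0]
    have := Real.log_natCast_nonneg (S.card + T.card)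
    push_cast at this
    simp only [Finset.card_empty, Nat.cast_zero, mul_zero, zero_mul]
    positivity
  | insert i K _ ih =>
    have same (c : Bool) := ih (S.filter (· i = c)) (T.filter (· i = c)) (by
      intro x hx y hy j hj
      rw [Finset.mem_filter] at hx hy
      by_cases hji : j = i
      · rw [hji, hx.2, hy.2]
      · exact hK x hx.1 y hy.1 j (by simp [hji, hj]))
    have cross (c : Bool) := card_hammingOnePairs_le_min (S := S.filter (· i = c))
      (T := T.filter (· i = !c)) i c (fun x hx => (Finset.mem_filter.1 hx).2)
      (fun y hy => (Finset.mem_filter.1 hy).2)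
    have h0 := same false
    have h1 := same true
    have h01 := cross false
    have h10 := cross true
    have hsplit := card_hammingOnePairs_le_split S T i
    have card_split (U : Finset (ι → Bool)) :
        U.card = (U.filter (· i = false)).card + (U.filter (· i = true)).card := by
      rw [← Finset.card_filter_add_card_filter_not (s := U) (· i = false)]
      simp
    have hS := card_split S
    have hT := card_split T
    simp only [Bool.not_false, Bool.not_true] at h01 h10
    generalize (S.filter (· i = false)).card = s₀ at *
    generalize (S.filter (· i = true)).card = s₁ at *
    generalize (T.filter (· i = false)).card = t₀ at *
    generalize (T.filter (· i = true)).card = t₁ at *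
    have hcount : (hammingOnePairs S T).card ≤
        (hammingOnePairs (S.filter (· i = false)) (T.filter (· i = false))).card +
        (hammingOnePairs (S.filter (· i = true)) (T.filter (· i = true))).card +
        min (s₀ + t₀) (s₁ + t₁) := by omega
    have hcount' : ((hammingOnePairs S T).card : ℝ) ≤
        (hammingOnePairs (S.filter (· i = false)) (T.filter (· i = false))).card +
        (hammingOnePairs (S.filter (· i = true)) (T.filter (· i = true))).card +
        min ((s₀ : ℝ) + t₀) (s₁ + t₁) := by exact_mod_cast hcount
    have key := mul_log_add_mul_log_add_min_le (x := (s₀ : ℝ) + t₀) (y := (s₁ : ℝ) + t₁)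
      (by positivity) (by positivity)
    have hsum : (S.card : ℝ) + T.card = (s₀ + t₀) + (s₁ + t₁) := by
      rw [hS, hT]
      push_cast
      ring
    rw [hsum]
    nlinarith [mul_le_mul_of_nonneg_right hcount' (Real.log_nonneg one_le_two)]

end HammingOnePairs


/-- For any `q ≥ 1` and sets `S, T` of bit strings of length `b` with
`|S| ≤ q` and `|T| ≤ q`, the number of pairs `(x,y) ∈ S × T` at Hamming distance
exactly 1 is at most `q·log₂(2q)`. -/
theorem hamming_one_pairs_bound (b q : ℕ) (hb : 1 ≤ b) (hq : 1 ≤ q)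
    (S T : Finset (Fin b → Bool)) (hS : S.card ≤ q) (hT : T.card ≤ q) :
    (((S ×ˢ T).filter (fun p => hammingDist p.1 p.2 = 1)).card : ℝ)
      ≤ (q : ℝ) * Real.logb 2 (2 * q) := by
  have h := card_hammingOnePairs_mul_log_two_le Finset.univ S T (by simp)
  have hlog2 : 0 < Real.log 2 := Real.log_pos one_lt_two
  have hq' : (1 : ℝ) ≤ q := by exact_mod_cast hq
  have hn : (S.card : ℝ) + T.card ≤ 2 * q := by
    have : S.card + T.card ≤ 2 * q := by omega
    exact_mod_cast this
  have hlog : Real.log (S.card + T.card) ≤ Real.log (2 * q) := by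
    rcases (S.card + T.card).eq_zero_or_pos with h0 | h0
    · have h0' : (S.card : ℝ) + T.card = 0 := by exact_mod_cast h0
      rw [h0', Real.log_zero]
      exact Real.log_nonneg (by linarith)
    · exact Real.log_le_log (by exact_mod_cast h0) hn
  have hmul : ((S.card : ℝ) + T.card) * Real.log (S.card + T.card) ≤ 2 * q * Real.log (2 * q) :=
    (mul_le_mul_of_nonneg_left hlog (by positivity)).trans
      (mul_le_mul_of_nonneg_right hn (Real.log_nonneg (by linarith)))
  rw [Real.logb, ← mul_div_assoc, le_div_iff₀ hlog2]
  change ((hammingOnePairs S T).card : ℝ) * Real.log 2 ≤ _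
  linarith
end

section
/- Let E be the directed Hamming-distance-1 problem on strings of length b, and suppose q ≥ C(b, ⌊b/2⌋) (the maximum binomial coefficient). Then E has a mapping schema of reducer size q with b reducers, where for each w = 0, 1, …, b−1 reducer w receives S_w = {x ∈ X : weight(x) = w} and T_w = {y ∈ Y : weight(y) = w+1}; every input is assigned to at most one reducer, so the replication rate of this schema is at most 1. -/
theorem card_filter_bool_weight_eq_choose (b k : ℕ) :
    (Finset.univ.filter
      (fun x : Fin b → Bool => (Finset.univ.filter (fun i => x i)).card = k)).card
      = b.choose k := by
  have h : (Finset.powersetCard k (Finset.univ : Finset (Fin b))).card = b.choose k := by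
    simp
  rw [← h]
  refine Finset.card_bij' (fun x _ => Finset.univ.filter (fun i => x i))
    (fun s _ i => decide (i ∈ s)) ?_ ?_ ?_ ?_
  · intro x hx
    simpa [Finset.mem_powersetCard] using hx
  · intro s hs
    simpa [Finset.mem_powersetCard] using hs
  · intro x _
    ext i
    simp
  · intro s _
    ext i
    simp

theorem card_filter_mem_fiber_le_one {ι α β : Type*} [Fintype ι] [Fintype α] [DecidableEq β]
    (f : α → β) {g : ι → β} (hg : Function.Injective g) (x : α)
    [DecidablePred fun w => x ∈ Finset.univ.filter (fun x => f x = g w)] :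
    (Finset.univ.filter (fun w => x ∈ Finset.univ.filter (fun x => f x = g w))).card ≤ 1 := by
  refine Finset.card_le_one.2 fun v hv w hw => hg ?_
  simp only [Finset.mem_filter, Finset.mem_univ, true_and] at hv hw
  exact hv.symm.trans hw

theorem sum_card_fiber_le_card {ι α β : Type*} [Fintype ι] [Fintype α] [DecidableEq β]
    (f : α → β) {g : ι → β} (hg : Function.Injective g) :
    ∑ w, (Finset.univ.filter (fun x => f x = g w)).card ≤ Fintype.card α := by
  classical
  rw [← Finset.card_biUnion]
  · exact Finset.card_le_univ _
  · intro v _ w _ hvw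
    refine Finset.disjoint_filter.2 fun x _ hv hw => hvw (hg (hv.symm.trans hw))

/-- For the directed Hamming-distance-1 problem on bit strings of length
`b`, if `q ≥ C(b, ⌊b/2⌋)`, then there is a mapping schema with `b` reducers where
reducer `w` receives the strings of weight `w` from `X` and the strings of weight
`w + 1` from `Y`; every input is assigned to at most one reducer, so the replication
rate is at most 1. -/
theorem directed_hamming_weight_schema (b q : ℕ) (hb : 1 ≤ b)
    (hq : Nat.choose b (b / 2) ≤ q) :
    ∃ S T : Fin b → Finset (Fin b → Bool),
      (∀ w, S w = Finset.univ.filter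
        (fun x : Fin b → Bool => (Finset.univ.filter (fun i => x i)).card = (w : ℕ))) ∧
      (∀ w, T w = Finset.univ.filter
        (fun y : Fin b → Bool => (Finset.univ.filter (fun i => y i)).card = (w : ℕ) + 1)) ∧
      (∀ w, (S w).card ≤ q) ∧ (∀ w, (T w).card ≤ q) ∧
      (∀ x y : Fin b → Bool, hammingDist x y = 1 →
        (Finset.univ.filter (fun i => y i)).card
          = (Finset.univ.filter (fun i => x i)).card + 1 →
        ∃ w, x ∈ S w ∧ y ∈ T w) ∧
      (∀ x : Fin b → Bool, (Finset.univ.filter (fun w => x ∈ S w)).card ≤ 1) ∧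
      (∀ y : Fin b → Bool, (Finset.univ.filter (fun w => y ∈ T w)).card ≤ 1) ∧
      (∑ w, ((S w).card + (T w).card : ℝ)) / (2 * 2 ^ b) ≤ 1 := by
  have hS : Function.Injective (fun w : Fin b => (w : ℕ)) := Fin.val_injective
  have hT : Function.Injective (fun w : Fin b => (w : ℕ) + 1) :=
    (add_left_injective 1).comp Fin.val_injective
  let weight : (Fin b → Bool) → ℕ := fun x => (Finset.univ.filter (fun i => x i)).card
  refine ⟨_, _, fun w => rfl, fun w => rfl, fun w => ?_, fun w => ?_, ?_,
    fun x => card_filter_mem_fiber_le_one weight hS x, fun x => card_filter_mem_fiber_le_one weight hT x, ?_⟩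
  · exact (card_filter_bool_weight_eq_choose b w).trans_le ((Nat.choose_le_middle _ _).trans hq)
  · exact (card_filter_bool_weight_eq_choose b _).trans_le ((Nat.choose_le_middle _ _).trans hq)
  · intro x y _ hxy
    have hy : (Finset.univ.filter (fun i => y i)).card ≤ b := by
      simpa using Finset.card_le_univ (Finset.univ.filter (fun i => y i))
    exact ⟨⟨(Finset.univ.filter (fun i => x i)).card, by omega⟩, by simp, by simpa using hxy⟩
  · have h₁ := sum_card_fiber_le_card weight hS
    have h₂ := sum_card_fiber_le_card weight hT
    have h := add_le_add h₁ h₂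
    simp only [Fintype.card_fun, Fintype.card_bool, Fintype.card_fin, ← two_mul,
      ← Finset.sum_add_distrib] at h
    refine div_le_one_of_le₀ ?_ (by positivity)
    exact_mod_cast h
end

section
/- Let E be the directed Hamming-distance-1 problem on strings of length b, and let q = 2^k for some natural number k with 0 ≤ k ≤ b. Then E has a mapping schema of reducer size q whose replication rate is at most 1 + (b − k)/2, i.e., at most 1 + (1/2)·log₂(n/q). -/
/-- If two bit strings differ only in position `j` and the second has larger weight, then
the bit in position `j` goes from `false` to `true`. -/
lemma bit_flip_of_weight_lt {ι : Type*} [Fintype ι] {x y : ι → Bool} {j : ι}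
    (hj : ∀ i, x i ≠ y i → i = j)
    (hw : (Finset.univ.filter (fun i => x i)).card < (Finset.univ.filter (fun i => y i)).card) :
    x j = false ∧ y j = true := by
  by_contra hxy
  refine absurd (Finset.card_le_card fun i hi => ?_) (not_le.2 hw)
  simp only [Finset.mem_filter, Finset.mem_univ, true_and] at hi ⊢
  by_contra hx
  have hij : i = j := hj i fun h => hx (h.trans hi)
  subst hij
  exact hxy ⟨by simpa using hx, hi⟩

/-- A subcube obtained by fixing the coordinates satisfying `P` has at most `2 ^ d` points, where
`d` is the number of free coordinates. -/
lemma card_filter_restrict_eq_le {ι : Type*} [Fintype ι] [DecidableEq ι] (P : ι → Prop)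
    [DecidablePred P] (v : {i // P i} → Bool) :
    (Finset.univ.filter fun x : ι → Bool => (fun i : {i // P i} => x i) = v).card
      ≤ 2 ^ Fintype.card {i // ¬ P i} := by
  have hcard : (Finset.univ : Finset ({i // ¬ P i} → Bool)).card
      = 2 ^ Fintype.card {i // ¬ P i} := by simp
  rw [← hcard]
  refine Finset.card_le_card_of_injOn (fun x i => x i) (by simp) fun x hx y hy hxy => ?_
  simp only [Finset.coe_filter, Finset.mem_univ, true_and, Set.mem_ofPred_eq] at hx hy
  funext i
  by_cases hi : P i
  · exact congrFun (hx.trans hy.symm) ⟨i, hi⟩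
  · exact congrFun hxy ⟨i, hi⟩

/-- The bit string with bit `c` in position `j` and the bits of `w` elsewhere. -/
def insertBit {ι : Type*} [DecidableEq ι] (j : ι) (c : Bool) (w : {i // i ≠ j} → Bool) :
    ι → Bool :=
  fun i => if h : i = j then c else w ⟨i, h⟩

/-- A schema with reducers the subcubes fixing the coordinates `≥ k`, together with one
single-edge reducer for each edge in a direction `≥ k`. -/
abbrev ReducerIndex (b k : ℕ) : Type :=
  ({j : Fin b // k ≤ j.val} → Bool) ⊕ (Σ j : {j : Fin b // k ≤ j.val}, {i // i ≠ j.1} → Bool)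

/-- The strings assigned to a reducer, on the side given by `c` (`false` for the lower endpoints
of edges and `true` for the upper ones). -/
def reducerInputs (b k : ℕ) (c : Bool) : ReducerIndex b k → Finset (Fin b → Bool)
  | .inl v => Finset.univ.filter fun x => (fun j : {j : Fin b // k ≤ j.val} => x j) = v
  | .inr e => {insertBit e.1.1 c e.2}

lemma card_fin_not_le {b k : ℕ} (hk : k ≤ b) : Fintype.card {j : Fin b // ¬ k ≤ j.val} = k := by
  simp only [not_le, Fintype.card_subtype, Fin.card_filter_val_lt]
  omega

lemma card_fin_le {b k : ℕ} (hk : k ≤ b) : Fintype.card {j : Fin b // k ≤ j.val} = b - k := by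
  have h := Fintype.card_subtype_compl (fun j : Fin b => k ≤ j.val)
  have h' := Fintype.card_subtype_le (fun j : Fin b => k ≤ j.val)
  rw [card_fin_not_le hk] at h
  simp only [Fintype.card_fin] at h h'
  omega

lemma card_reducerInputs_le {b k : ℕ} (hk : k ≤ b) (c : Bool) (r : ReducerIndex b k) :
    (reducerInputs b k c r).card ≤ 2 ^ k := by
  rcases r with v | e
  · have h := card_filter_restrict_eq_le (fun j : Fin b => k ≤ j.val) v
    rwa [card_fin_not_le hk] at h
  · simpa [reducerInputs] using Nat.one_le_two_pow

lemma sum_card_reducerInputs {b k : ℕ} (hk : k ≤ b) (c : Bool) :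
    ∑ r, (reducerInputs b k c r).card = 2 ^ b + (b - k) * 2 ^ (b - 1) := by
  rw [Fintype.sum_sum_type]
  congr 1
  · simp only [reducerInputs]
    rw [← Finset.card_eq_sum_card_fiberwise (by simp)]
    simp
  · simp [reducerInputs, Fintype.card_sigma, card_fin_le hk]

lemma exists_reducer_of_edge {b : ℕ} (k : ℕ) {x y : Fin b → Bool} (hxy : hammingDist x y = 1)
    (hw : (Finset.univ.filter (fun j => x j)).card < (Finset.univ.filter (fun j => y j)).card) :
    ∃ r, x ∈ reducerInputs b k false r ∧ y ∈ reducerInputs b k true r := by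
  obtain ⟨j, hj⟩ := Finset.card_eq_one.1 hxy
  have hj' : ∀ i, x i ≠ y i → i = j := fun i hi => by
    have : i ∈ ({j} : Finset (Fin b)) := hj ▸ by simpa using hi
    simpa using this
  obtain ⟨hxj, hyj⟩ := bit_flip_of_weight_lt hj' hw
  by_cases hkj : k ≤ j.val
  · refine ⟨.inr ⟨⟨j, hkj⟩, fun i => x i⟩, ?_, ?_⟩ <;>
      simp only [reducerInputs, Finset.mem_singleton] <;> funext i <;>
      by_cases hi : i = j
    · simp [insertBit, hi, hxj]
    · simp [insertBit, hi]
    · simp [insertBit, hi, hyj]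
    · simpa [insertBit, hi] using (not_imp_comm.1 (hj' i) hi).symm
  · refine ⟨.inl fun i => x i, by simp [reducerInputs], ?_⟩
    simp only [reducerInputs, Finset.mem_filter, Finset.mem_univ, true_and]
    funext i
    by_contra hi
    exact hkj (hj' i (Ne.symm hi) ▸ i.2)

/-- For the directed Hamming-distance-1 problem on bit strings of length
`b`, with reducer size `q = 2^k` for some `k ≤ b`, there is a mapping schema whose
replication rate is at most `1 + (b − k)/2 = 1 + (1/2)·log₂(n/q)`. -/
theorem directed_hamming_recursive_schema (b k : ℕ) (hb : 1 ≤ b) (hk : k ≤ b) :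
    ∃ (p : ℕ) (S T : Fin p → Finset (Fin b → Bool)),
      (∀ i, (S i).card ≤ 2 ^ k) ∧ (∀ i, (T i).card ≤ 2 ^ k) ∧
      (∀ x y : Fin b → Bool, hammingDist x y = 1 →
        (Finset.univ.filter (fun j => y j)).card
          = (Finset.univ.filter (fun j => x j)).card + 1 →
        ∃ i, x ∈ S i ∧ y ∈ T i) ∧
      (∑ i, ((S i).card + (T i).card : ℝ)) / (2 * 2 ^ b)
        ≤ 1 + ((b : ℝ) - k) / 2 := by
  let e := (Fintype.equivFin (ReducerIndex b k)).symm
  refine ⟨Fintype.card (ReducerIndex b k), fun i => reducerInputs b k false (e i),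
    fun i => reducerInputs b k true (e i), fun i => card_reducerInputs_le hk _ _,
    fun i => card_reducerInputs_le hk _ _, fun x y hxy hw => ?_, ?_⟩
  · obtain ⟨r, hr⟩ := exists_reducer_of_edge k hxy (by omega)
    exact ⟨e.symm r, by simpa using hr⟩
  · have hsum (c : Bool) : ∑ i, ((reducerInputs b k c (e i)).card : ℝ)
        = 2 ^ b + ((b : ℝ) - k) * 2 ^ (b - 1) := by
      rw [e.sum_comp fun r => ((reducerInputs b k c r).card : ℝ), ← Nat.cast_sub hk]
      exact_mod_cast sum_card_reducerInputs hk c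
    rw [Finset.sum_add_distrib, hsum, hsum]
    obtain ⟨m, rfl⟩ := Nat.exists_eq_add_of_le' hb
    apply le_of_eq
    rw [Nat.add_sub_cancel, pow_succ]
    field_simp
    ring
end
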